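/- arXiv:2310.04107 — 12 statements merged into one kernel-verified Lean document; each statement's English description precedes it below -/
import Mathlib

section
/- For all integers l ≥ 1 and m ≥ 1, the characteristic polynomial of the adjacency matrix of the double subdivided star T_{l,m} equals (x^2 - 1)^{l+m-2} · (x^6 - (l+m+3)x^4 + (lm+l+m+3)x^2 - 1). -/
/-- Vertices of the double subdivided star `T_{l,m}`: coalescence vertices `a`, `b`;
pendant vertices `x j` and middle vertices `y j` on the `l`-branch side;
pendant vertices `u k` and middle vertices `w k` on the `m`-branch side. -/
inductive DV (l m : ℕ) : Type
  | a : DV l m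
  | b : DV l m
  | x : Fin l → DV l m
  | y : Fin l → DV l m
  | u : Fin m → DV l m
  | w : Fin m → DV l m
  deriving DecidableEq, Fintype

/-- The adjacency relation of `T_{l,m}`: `a∼b`, `a∼y j`, `y j∼x j`, `b∼w k`, `w k∼u k`. -/
def DV.adj {l m : ℕ} : DV l m → DV l m → Bool
  | .a, .b => true
  | .b, .a => true
  | .a, .y _ => true
  | .y _, .a => true
  | .x j, .y j' => j = j'
  | .y j, .x j' => j = j'
  | .b, .w _ => true
  | .w _, .b => true
  | .u k, .w k' => k = k'
  | .w k, .u k' => k = k'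
  | _, _ => false

/-- The adjacency matrix of the double subdivided star `T_{l,m}` with entries in `R`. -/
def adjMat (l m : ℕ) (R : Type*) [Zero R] [One R] :
    Matrix (DV l m) (DV l m) R :=
  fun u v => if u.adj v then 1 else 0

open Polynomial

/-- The vertices of `T_{l,m}`, grouped as centres, middle vertices and pendant vertices. -/
def DV.sumEquiv (l m : ℕ) : (Fin 2 ⊕ (Fin l ⊕ Fin m)) ⊕ (Fin l ⊕ Fin m) ≃ DV l m where
  toFun
    | .inl (.inl i) => if i = 0 then .a else .b
    | .inl (.inr (.inl j)) => .y j
    | .inl (.inr (.inr k)) => .w k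
    | .inr (.inl j) => .x j
    | .inr (.inr k) => .u k
  invFun
    | .a => .inl (.inl 0)
    | .b => .inl (.inl 1)
    | .y j => .inl (.inr (.inl j))
    | .w k => .inl (.inr (.inr k))
    | .x j => .inr (.inl j)
    | .u k => .inr (.inr k)
  left_inv := by
    rintro ((i | j | k) | j | k)
    · fin_cases i <;> rfl
    all_goals rfl
  right_inv := by rintro (_ | _ | _ | _ | _ | _) <;> rfl

/-- The biadjacency matrix between the centres and the middle vertices of `T_{l,m}`. -/
def centreMiddle (l m : ℕ) (R : Type*) [Zero R] [One R] :
    Matrix (Fin 2) (Fin l ⊕ Fin m) R :=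
  Matrix.of ![Sum.elim 1 0, Sum.elim 0 1]

theorem centreMiddle_mul_transpose (l m : ℕ) (R : Type*) [CommRing R] :
    centreMiddle l m R * (centreMiddle l m R).transpose = !![(l : R), 0; 0, (m : R)] := by
  ext i j
  fin_cases i <;> fin_cases j <;> simp [centreMiddle, Matrix.mul_apply]

theorem submatrix_scalar_sub_adjMat (l m : ℕ) {R : Type*} [CommRing R] (t : R) :
    (Matrix.scalar (DV l m) t - adjMat l m R).submatrix (DV.sumEquiv l m) (DV.sumEquiv l m) =
      Matrix.fromBlocks
        (Matrix.fromBlocks !![t, -1; -1, t] (-centreMiddle l m R)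
          (-(centreMiddle l m R).transpose) (t • 1))
        (Matrix.fromRows 0 (-1)) (Matrix.fromCols 0 (-1)) (t • 1) := by
  ext ((i | j | j) | j | j) ((i' | j' | j') | j' | j')
  all_goals try fin_cases i
  all_goals try fin_cases i'
  all_goals
    simp [DV.sumEquiv, adjMat, DV.adj, centreMiddle, Matrix.one_apply, Matrix.diagonal_apply]

/-- Determinant of a graph-type block matrix in which every vertex of the second block
carries a pendant vertex. -/
theorem det_fromBlocks_pendant {n q K : Type*} [Fintype n] [DecidableEq n] [Fintype q]
    [DecidableEq q] [Field K] (A : Matrix n n K) (B : Matrix n q K) (C : Matrix q n K)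
    {t : K} (ht : t ≠ 0) (ht' : t ^ 2 - 1 ≠ 0) :
    (Matrix.fromBlocks (Matrix.fromBlocks A B C (t • 1))
        (Matrix.fromRows (0 : Matrix n q K) (-1 : Matrix q q K))
        (Matrix.fromCols (0 : Matrix q n K) (-1 : Matrix q q K)) (t • 1)).det =
      (t ^ 2 - 1) ^ Fintype.card q * (A - (t / (t ^ 2 - 1)) • (B * C)).det := by
  have hs : t - t⁻¹ ≠ 0 := by
    intro h
    apply ht'
    field_simp at h
    simpa using h
  have invertible_smul {s : K} (hs : s ≠ 0) : Invertible (s • (1 : Matrix q q K)) :=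
    ⟨s⁻¹ • 1, by simp [hs], by simp [hs]⟩
  let := invertible_smul ht
  let := invertible_smul hs
  have hinv {s : K} (hs : s ≠ 0) [Invertible (s • (1 : Matrix q q K))] :
      ⅟(s • (1 : Matrix q q K)) = s⁻¹ • 1 :=
    invOf_eq_right_inv (by simp [hs])
  have hblock : Matrix.fromBlocks A B C (t • 1) -
      Matrix.fromRows (0 : Matrix n q K) (-1 : Matrix q q K) * ⅟(t • (1 : Matrix q q K)) *
          Matrix.fromCols (0 : Matrix q n K) (-1 : Matrix q q K) =
      Matrix.fromBlocks A B C ((t - t⁻¹) • 1) := by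
    rw [hinv ht]
    ext (i | i) (j | j) <;>
      simp [Matrix.mul_fromCols, sub_mul]
  rw [Matrix.det_fromBlocks₂₂, hblock, Matrix.det_fromBlocks₂₂, hinv hs, Matrix.det_smul,
    Matrix.det_smul, Matrix.det_one, mul_one, mul_one, ← mul_assoc, ← mul_pow]
  have h1 : t * (t - t⁻¹) = t ^ 2 - 1 := by field_simp
  have h2 : (t - t⁻¹)⁻¹ = t / (t ^ 2 - 1) := by
    rw [← h1]
    field_simp
  rw [h1, h2, Matrix.mul_smul, Matrix.mul_one, Matrix.smul_mul]

/-- For all integers `l ≥ 1` and `m ≥ 1`, the characteristic polynomial of the adjacency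
matrix of the double subdivided star `T_{l,m}` equals
`(x² - 1)^(l+m-2) · (x⁶ - (l+m+3)x⁴ + (lm+l+m+3)x² - 1)`. -/
theorem charpoly_doubleSubdividedStar (l m : ℕ) (hl : 1 ≤ l) (hm : 1 ≤ m) :
    (adjMat l m ℚ).charpoly =
      (X ^ 2 - 1) ^ (l + m - 2) *
        (X ^ 6 - C ((l : ℚ) + (m : ℚ) + 3) * X ^ 4
          + C ((l : ℚ) * (m : ℚ) + (l : ℚ) + (m : ℚ) + 3) * X ^ 2 - 1) := by
  refine Polynomial.eq_of_infinite_eval_eq _ _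
    (((Set.finite_singleton (0 : ℚ)).union
      (Set.toFinite {1, -1})).infinite_compl.mono fun t ht => ?_)
  simp only [Set.mem_compl_iff, Set.mem_union, Set.mem_singleton_iff, Set.mem_insert_iff,
    not_or] at ht
  obtain ⟨ht0, ht1, ht2⟩ := ht
  have hs : t ^ 2 - 1 ≠ 0 := by
    intro h
    rcases sq_eq_sq_iff_eq_or_eq_neg.mp ((sub_eq_zero.mp h).trans (one_pow 2).symm) with h | h <;>
      contradiction
  have hpow : (t ^ 2 - 1) ^ (l + m) = (t ^ 2 - 1) ^ (l + m - 2) * (t ^ 2 - 1) ^ 2 := by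
    rw [← pow_add, Nat.sub_add_cancel (by omega)]
  rw [Set.mem_ofPred_eq, Matrix.eval_charpoly,
    ← Matrix.det_submatrix_equiv_self (DV.sumEquiv l m), submatrix_scalar_sub_adjMat,
    det_fromBlocks_pendant _ _ _ ht0 hs, Matrix.neg_mul, Matrix.mul_neg, neg_neg,
    centreMiddle_mul_transpose,
    Matrix.det_fin_two]
  simp only [Fintype.card_sum, Fintype.card_fin, hpow]
  simp
  field_simp
  ring
end

section
/- For all integers l ≥ 1 and m ≥ 1, the polynomial Q(x) = x^3 - (l+m+3)x^2 + (lm+l+m+3)x - 1 has three distinct real roots, each of which is positive and none of which equals 1. -/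
open Polynomial

/-- A monic real cubic with three distinct roots has no other roots. -/
theorem monic_cubic_eq_zero_iff {S P R a b c : ℝ} (hab : a ≠ b) (hac : a ≠ c) (hbc : b ≠ c)
    (ha : a ^ 3 - S * a ^ 2 + P * a - R = 0) (hb : b ^ 3 - S * b ^ 2 + P * b - R = 0)
    (hc : c ^ 3 - S * c ^ 2 + P * c - R = 0) (t : ℝ) :
    t ^ 3 - S * t ^ 2 + P * t - R = 0 ↔ t = a ∨ t = b ∨ t = c := by
  have h_ab : a ^ 2 + a * b + b ^ 2 - S * (a + b) + P = 0 :=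
    mul_left_cancel₀ (sub_ne_zero.mpr hab) (by linear_combination ha - hb)
  have h_ac : a ^ 2 + a * c + c ^ 2 - S * (a + c) + P = 0 :=
    mul_left_cancel₀ (sub_ne_zero.mpr hac) (by linear_combination ha - hc)
  have h_sum : a + b + c - S = 0 :=
    mul_left_cancel₀ (sub_ne_zero.mpr hbc) (by linear_combination h_ab - h_ac)
  have h_factor : t ^ 3 - S * t ^ 2 + P * t - R = (t - a) * ((t - b) * (t - c)) := by
    linear_combination ha + (t - a) * h_ab + (t - a) * (t - b) * h_sum
  rw [h_factor, mul_eq_zero, mul_eq_zero, sub_eq_zero, sub_eq_zero, sub_eq_zero]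

/-- For all integers `l ≥ 1` and `m ≥ 1`, the polynomial
`Q(x) = x³ - (l+m+3)x² + (lm+l+m+3)x - 1` has three distinct real roots,
each of which is positive and none of which equals `1`. -/
theorem cubic_three_distinct_positive_roots (l m : ℕ) (hl : 1 ≤ l) (hm : 1 ≤ m) :
    ∃ μ₁ μ₂ μ₃ : ℝ, μ₁ ≠ μ₂ ∧ μ₁ ≠ μ₃ ∧ μ₂ ≠ μ₃ ∧
      0 < μ₁ ∧ 0 < μ₂ ∧ 0 < μ₃ ∧ μ₁ ≠ 1 ∧ μ₂ ≠ 1 ∧ μ₃ ≠ 1 ∧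
      (∀ t : ℝ,
        t ^ 3 - ((l : ℝ) + (m : ℝ) + 3) * t ^ 2
            + ((l : ℝ) * (m : ℝ) + (l : ℝ) + (m : ℝ) + 3) * t - 1 = 0 ↔
          t = μ₁ ∨ t = μ₂ ∨ t = μ₃) := by
  have hl' : (1 : ℝ) ≤ l := by exact_mod_cast hl
  have hm' : (1 : ℝ) ≤ m := by exact_mod_cast hm
  generalize (l : ℝ) = x at *
  generalize (m : ℝ) = y at *
  have hxy : 0 < x * y := by positivity
  let Q : ℝ → ℝ := fun t => t ^ 3 - (x + y + 3) * t ^ 2 + (x * y + x + y + 3) * t - 1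
  have hQ : Continuous Q := by fun_prop
  have h_zero : Q 0 < 0 := by simp [Q]
  have h_one : 0 < Q 1 := by simp only [Q]; linarith
  have h_mid : Q (x + 1) < 0 := by
    have h_eq : Q (x + 1) = -x ^ 2 := by simp only [Q]; ring
    rw [h_eq]
    exact neg_neg_of_pos (by positivity)
  have h_top : 0 < Q (x + y + 3) := by
    have h_eq : Q (x + y + 3) = (x * y + x + y + 3) * (x + y + 3) - 1 := by
      simp only [Q]; ring
    rw [h_eq]
    nlinarith
  obtain ⟨a, ⟨ha₀, ha₁⟩, ha⟩ :=
    intermediate_value_Ioo zero_le_one hQ.continuousOn ⟨h_zero, h_one⟩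
  obtain ⟨b, ⟨hb₀, hb₁⟩, hb⟩ :=
    intermediate_value_Ioo' (by linarith : 1 ≤ x + 1) hQ.continuousOn ⟨h_mid, h_one⟩
  obtain ⟨c, ⟨hc₀, -⟩, hc⟩ :=
    intermediate_value_Ioo (by linarith : x + 1 ≤ x + y + 3) hQ.continuousOn ⟨h_mid, h_top⟩
  have hab : a ≠ b := (ha₁.trans hb₀).ne
  have hac : a ≠ c := (ha₁.trans (by linarith)).ne
  have hbc : b ≠ c := (hb₁.trans hc₀).ne
  exact ⟨a, b, c, hab, hac, hbc, ha₀, by linarith, by linarith, ha₁.ne, hb₀.ne',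
    (show 1 < c by linarith).ne', monic_cubic_eq_zero_iff hab hac hbc ha hb hc⟩
end

section
/- Let l ≥ 1 and m ≥ 1 be integers and q(x) = x^6 - (l+m+3)x^4 + (lm+l+m+3)x^2 - 1 ∈ ℚ[x]. If q(x) is reducible over ℚ, then there exists a monic irreducible cubic polynomial f ∈ ℚ[x] such that q(x) = -f(x)·f(-x). -/
open Polynomial

/-- A monic integer cubic with constant term `-1` is irreducible over `ℚ` as soon as neither `1`
nor `-1` is a root. -/
theorem irreducible_cubic_of_constantCoeff_neg_one (a b : ℤ) (h₁ : b ≠ a) (h₂ : a + b + 2 ≠ 0) :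
    Irreducible (X ^ 3 - C (a : ℚ) * X ^ 2 + C (b : ℚ) * X - 1 : ℚ[X]) := by
  have hdeg : (X ^ 3 - C (a : ℚ) * X ^ 2 + C (b : ℚ) * X - 1 : ℚ[X]).natDegree = 3 := by
    compute_degree!
  refine (irreducible_iff_roots_eq_zero_of_degree_le_three (by rw [hdeg]; norm_num) hdeg.le).2 ?_
  refine Multiset.eq_zero_of_forall_notMem fun r hr => ?_
  have hr : r ^ 3 - a * r ^ 2 + b * r - 1 = 0 := by simpa using isRoot_of_mem_roots hr
  have hmonic : (X ^ 3 - C a * X ^ 2 + C b * X - 1 : ℤ[X]).Monic := by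
    monicity!
  obtain ⟨n, hn⟩ := isInteger_of_is_root_of_monic hmonic (r := r) (by simpa using hr)
  obtain rfl : (n : ℚ) = r := by simpa using hn
  have hn : n * (n ^ 2 - a * n + b) = 1 := by
    have : (n * (n ^ 2 - a * n + b) : ℚ) = 1 := by linear_combination hr
    exact_mod_cast this
  rcases Int.eq_one_or_neg_one_of_mul_eq_one hn with rfl | rfl
  · exact h₁ (by linarith)
  · exact h₂ (by linarith)

/-- If `Q` is irreducible of degree `n` and `Q(α²) = 0`, then `α` has degree at least `n`. -/
theorem natDegree_le_natDegree_minpoly_of_aeval_sq_eq_zero {K L : Type*} [Field K] [Field L]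
    [Algebra K L] {Q : K[X]} (hQ : Irreducible Q) {α : L} (hα : IsIntegral K α)
    (h : aeval (α ^ 2) Q = 0) : Q.natDegree ≤ (minpoly K α).natDegree := by
  have : FiniteDimensional K (IntermediateField.adjoin K {α}) :=
    IntermediateField.adjoin.finiteDimensional hα
  have hmem : α ∈ IntermediateField.adjoin K {α} := IntermediateField.mem_adjoin_simple_self K α
  have hle := minpoly.natDegree_le (A := K) (⟨α, hmem⟩ ^ 2 : IntermediateField.adjoin K {α})
  rw [IntermediateField.adjoin.finrank hα] at hle
  refine le_trans (natDegree_le_of_dvd ?_ (minpoly.ne_zero (hα.pow 2))) (le_of_eq_of_le ?_ hle)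
  · exact ((minpoly.irreducible (hα.pow 2)).dvd_symm hQ (minpoly.dvd K _ h))
  · rw [← minpoly.algebraMap_eq (algebraMap (IntermediateField.adjoin K {α}) L).injective]
    rfl

/-- If an even polynomial `q` with `q(0) ≠ 0` is monic of degree `2n`, `n` odd, then a monic
irreducible factor `f` of degree `n` yields the factorization `q(x) = -f(x)f(-x)`. -/
theorem eq_neg_mul_comp_neg_X_of_dvd {K : Type*} [Field K] [NeZero (2 : K)] {q f : K[X]} {n : ℕ}
    (hn : Odd n) (hq : q.Monic) (hqn : q.natDegree = 2 * n) (heven : q.comp (-X) = q)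
    (h0 : q.eval 0 ≠ 0) (hf : f.Monic) (hirr : Irreducible f) (hfn : f.natDegree = n)
    (hdvd : f ∣ q) : q = -(f * f.comp (-X)) := by
  have hg : (-f.comp (-X)).Monic := by
    rw [Monic, leadingCoeff_neg, leadingCoeff_comp (by simp), hf.leadingCoeff, hfn]
    simp [hn.neg_one_pow]
  have hgn : (-f.comp (-X)).natDegree = n := by simp [natDegree_comp, hfn]
  have hgdvd : -f.comp (-X) ∣ q := by
    obtain ⟨h, rfl⟩ := hdvd
    rw [← heven, mul_comp, neg_dvd]
    exact dvd_mul_right _ _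
  have hcop : IsCoprime f (-f.comp (-X)) := by
    refine (hirr.coprime_iff_not_dvd).2 fun hd => h0 ?_
    have heq := eq_of_monic_of_dvd_of_natDegree_le hf hg hd (by rw [hgn, hfn])
    have hf0 : f.eval 0 = 0 := by
      have := congrArg (eval 0) heq
      simp only [eval_neg, eval_comp, eval_X, neg_zero] at this
      have h2 : 2 * f.eval 0 = 0 := by linear_combination -this
      exact (mul_eq_zero.1 h2).resolve_left two_ne_zero
    obtain ⟨h, rfl⟩ := hdvd
    simp [hf0]
  rw [← mul_neg]
  refine (eq_of_monic_of_dvd_of_natDegree_le (hf.mul hg) hq (hcop.mul_dvd hdvd hgdvd) ?_)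
  rw [hf.natDegree_mul hg, hfn, hgn, hqn, two_mul]

/-- Let `l ≥ 1` and `m ≥ 1` be integers and
`q(x) = x⁶ - (l+m+3)x⁴ + (lm+l+m+3)x² - 1 ∈ ℚ[x]`. If `q(x)` is reducible over `ℚ`,
then there exists a monic irreducible cubic polynomial `f ∈ ℚ[x]` such that
`q(x) = -f(x)·f(-x)`. -/
theorem sextic_reducible_factorization (l m : ℕ) (hl : 1 ≤ l) (hm : 1 ≤ m)
    (q : ℚ[X])
    (hq : q = X ^ 6 - C ((l : ℚ) + (m : ℚ) + 3) * X ^ 4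
      + C ((l : ℚ) * (m : ℚ) + (l : ℚ) + (m : ℚ) + 3) * X ^ 2 - 1)
    (hred : ¬ Irreducible q) :
    ∃ f : ℚ[X], f.Monic ∧ Irreducible f ∧ f.natDegree = 3 ∧
      q = -(f * f.comp (-X)) := by
  set Q : ℚ[X] := X ^ 3 - C (((l + m + 3 : ℤ)) : ℚ) * X ^ 2
    + C (((l * m + l + m + 3 : ℤ)) : ℚ) * X - 1 with hQ
  have hl' : (0 : ℤ) < l := by exact_mod_cast hl
  have hm' : (0 : ℤ) < m := by exact_mod_cast hm
  have hQirr : Irreducible Q := by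
    have hlm := mul_pos hl' hm'
    exact irreducible_cubic_of_constantCoeff_neg_one _ _ (by linarith) (by linarith)
  have hQdeg : Q.natDegree = 3 := by rw [hQ]; compute_degree!
  have hqQ : q = Q.comp (X ^ 2) := by
    rw [hq, hQ]
    simp
    ring
  have hqdeg : q.natDegree = 6 := by rw [hqQ, natDegree_comp, hQdeg, natDegree_X_pow]
  have hqmonic : q.Monic := by rw [hq]; monicity!
  have hq1 : q ≠ 1 := by rintro rfl; simp at hqdeg
  obtain ⟨g, hgmonic, hgdeg, hgq⟩ :
      ∃ g : ℚ[X], g.Monic ∧ (0 < g.natDegree ∧ g.natDegree ≤ 3) ∧ g ∣ q := by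
    simpa [hqmonic.irreducible_iff_lt_natDegree_lt hq1, hqdeg, and_assoc] using hred
  obtain ⟨α, hα⟩ := IsAlgClosed.exists_aeval_eq_zero ℂ g
    (natDegree_pos_iff_degree_pos.1 hgdeg.1).ne'
  have hint : IsIntegral ℚ α := ⟨g, hgmonic, hα⟩
  have hαQ : aeval (α ^ 2) Q = 0 := by
    have := aeval_eq_zero_of_dvd_aeval_eq_zero hgq hα
    simpa [hqQ, aeval_comp] using this
  have hdvd : minpoly ℚ α ∣ g := minpoly.dvd ℚ α hα
  have hdeg : (minpoly ℚ α).natDegree = 3 :=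
    le_antisymm ((natDegree_le_of_dvd hdvd hgmonic.ne_zero).trans hgdeg.2)
      (hQdeg ▸ natDegree_le_natDegree_minpoly_of_aeval_sq_eq_zero hQirr hint hαQ)
  refine ⟨minpoly ℚ α, minpoly.monic hint, minpoly.irreducible hint, hdeg, ?_⟩
  refine eq_neg_mul_comp_neg_X_of_dvd (n := 3) (by decide) hqmonic hqdeg ?_ ?_
    (minpoly.monic hint) (minpoly.irreducible hint) hdeg (hdvd.trans hgq)
  · rw [hqQ, comp_assoc]
    simp
  · simp [hq]
end

section
/- Let l ≥ 1 and m ≥ 1 be integers and q(x) = x^6 - (l+m+3)x^4 + (lm+l+m+3)x^2 - 1 ∈ ℚ[x]. Suppose q(x) is reducible over ℚ, f ∈ ℚ[x] is a monic irreducible cubic factor of q, and θ₁, θ₂ are two distinct real roots of f. Then the real numbers 1, θ₁, θ₂ are linearly independent over ℚ. -/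
open Polynomial

/-- A real root of an irreducible rational cubic satisfies no nontrivial quadratic relation
over `ℚ`. -/
lemma quadratic_relation_trivial {f : ℚ[X]} (hmonic : f.Monic) (hirr : Irreducible f)
    (hdeg : f.natDegree = 3) {θ : ℝ} (hroot : aeval θ f = 0) {u v w : ℚ}
    (h : (u : ℝ) * θ ^ 2 + v * θ + w = 0) : u = 0 ∧ v = 0 ∧ w = 0 := by
  have hdvd : f ∣ C u * X ^ 2 + C v * X + C w := by
    rw [minpoly.eq_of_irreducible_of_monic hirr hroot hmonic]
    apply minpoly.dvd
    simpa using h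
  have hzero : C u * X ^ 2 + C v * X + C w = 0 := by
    refine eq_zero_of_dvd_of_natDegree_lt hdvd ?_
    rw [hdeg]
    exact natDegree_quadratic_le.trans_lt (by norm_num)
  refine ⟨?_, ?_, ?_⟩
  · simpa [coeff_X, coeff_C] using congrArg (coeff · 2) hzero
  · simpa [coeff_X, coeff_C] using congrArg (coeff · 1) hzero
  · simpa [coeff_X, coeff_C] using congrArg (coeff · 0) hzero

/-- A root of an irreducible rational cubic that is a rational affine function of another root
equals it. -/
lemma eq_of_affine_relation {f : ℚ[X]} (hmonic : f.Monic) (hirr : Irreducible f)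
    (hdeg : f.natDegree = 3) {θ₁ θ₂ : ℝ} (hroot₁ : aeval θ₁ f = 0) (hroot₂ : aeval θ₂ f = 0)
    {r s : ℚ} (h : θ₂ = r + s * θ₁) : θ₂ = θ₁ := by
  obtain ⟨a, b, c, hf⟩ : ∃ a b c : ℚ, f = X ^ 3 + C a * X ^ 2 + C b * X + C c := by
    refine ⟨f.coeff 2, f.coeff 1, f.coeff 0, ?_⟩
    have hlead : f.coeff 3 = 1 := hdeg ▸ hmonic.coeff_natDegree
    conv_lhs => rw [f.as_sum_range_C_mul_X_pow, hdeg]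
    simp only [Finset.sum_range_succ, Finset.sum_range_zero, hlead, map_one]
    ring
  have hnoroot : ∀ x : ℚ, ¬ f.IsRoot x := fun x hx => by
    have hdeg1 : f.natDegree = 1 :=
      natDegree_eq_of_degree_eq_some (degree_eq_one_of_irreducible_of_root hirr hx)
    omega
  have e₁ : θ₁ ^ 3 + a * θ₁ ^ 2 + b * θ₁ + c = 0 := by simpa [hf] using hroot₁
  have e₂ : θ₂ ^ 3 + a * θ₂ ^ 2 + b * θ₂ + c = 0 := by simpa [hf] using hroot₂
  obtain ⟨h2, h1, h0⟩ := quadratic_relation_trivial hmonic hirr hdeg hroot₁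
    (u := 3 * r * s ^ 2 + a * s ^ 2 - a * s ^ 3)
    (v := 3 * r ^ 2 * s + 2 * a * r * s + b * s - b * s ^ 3)
    (w := r ^ 3 + a * r ^ 2 + b * r + c - s ^ 3 * c) (by
      subst h
      push_cast
      linear_combination e₂ - (s : ℝ) ^ 3 * e₁)
  have hs : s ≠ 0 := by
    rintro rfl
    apply hnoroot r
    simp only [IsRoot.def, hf, eval_add, eval_mul, eval_pow, eval_X, eval_C]
    linear_combination h0
  have hr : r = a * (s - 1) / 3 := by
    have : s ^ 2 * (3 * r + a - a * s) = 0 := by linear_combination h2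
    have := (mul_eq_zero.mp this).resolve_left (pow_ne_zero 2 hs)
    linear_combination this / 3
  have hcube : f.eval (-a / 3) * (s ^ 3 - 1) = 0 := by
    simp only [hf, eval_add, eval_mul, eval_pow, eval_X, eval_C]
    subst hr
    linear_combination -h0 + a / 3 * h1
  have hs1 : s = 1 := by
    have h3 : (s - 1) * (s ^ 2 + s + 1) = 0 := by
      linear_combination (mul_eq_zero.mp hcube).resolve_left (hnoroot _)
    have : s ^ 2 + s + 1 ≠ 0 := by nlinarith [sq_nonneg (s + 1 / 2)]
    exact sub_eq_zero.mp ((mul_eq_zero.mp h3).resolve_right this)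
  subst hs1
  simp [h, hr]

/-- Let `l ≥ 1` and `m ≥ 1` be integers and
`q(x) = x⁶ - (l+m+3)x⁴ + (lm+l+m+3)x² - 1 ∈ ℚ[x]`. Suppose `q(x)` is reducible over `ℚ`,
`f ∈ ℚ[x]` is a monic irreducible cubic factor of `q`, and `θ₁, θ₂` are two distinct real
roots of `f`. Then the real numbers `1, θ₁, θ₂` are linearly independent over `ℚ`. -/
theorem one_root_root_linearIndependent (l m : ℕ) (hl : 1 ≤ l) (hm : 1 ≤ m)
    (q f : ℚ[X])
    (hq : q = X ^ 6 - C ((l : ℚ) + (m : ℚ) + 3) * X ^ 4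
      + C ((l : ℚ) * (m : ℚ) + (l : ℚ) + (m : ℚ) + 3) * X ^ 2 - 1)
    (hred : ¬ Irreducible q)
    (hmonic : f.Monic) (hirr : Irreducible f) (hdeg : f.natDegree = 3) (hdvd : f ∣ q)
    (θ₁ θ₂ : ℝ) (hne : θ₁ ≠ θ₂)
    (hroot₁ : aeval θ₁ f = 0) (hroot₂ : aeval θ₂ f = 0) :
    LinearIndependent ℚ ![(1 : ℝ), θ₁, θ₂] := by
  rw [Fintype.linearIndependent_iff]
  intro g hg
  have hg' : (g 0 : ℝ) + g 1 * θ₁ + g 2 * θ₂ = 0 := by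
    simpa [Fin.sum_univ_three, Rat.smul_def] using hg
  have hg2 : g 2 = 0 := by
    by_contra h2
    have h2' : (g 2 : ℝ) ≠ 0 := by exact_mod_cast h2
    refine hne (eq_of_affine_relation hmonic hirr hdeg hroot₁ hroot₂
      (r := -g 0 / g 2) (s := -g 1 / g 2) ?_).symm
    push_cast
    field_simp
    linear_combination hg'
  obtain ⟨-, hg1, hg0⟩ := quadratic_relation_trivial hmonic hirr hdeg hroot₁
    (u := 0) (v := g 1) (w := g 0) (by
      rw [hg2] at hg'
      push_cast at hg' ⊢
      linear_combination hg')
  intro i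
  fin_cases i <;> assumption
end

section
/- Let l ≥ 1 and m ≥ 1 be integers and q(x) = x^6 - (l+m+3)x^4 + (lm+l+m+3)x^2 - 1 ∈ ℚ[x]. If q(x) = -f(x)·f(-x) for some monic cubic polynomial f ∈ ℚ[x], then the coefficient of x^2 in f is nonzero (equivalently, the sum of the three roots of f is nonzero). -/
open Polynomial

/-- Let `l ≥ 1` and `m ≥ 1` be integers and
`q(x) = x⁶ - (l+m+3)x⁴ + (lm+l+m+3)x² - 1 ∈ ℚ[x]`. If `q(x) = -f(x)·f(-x)` for some monic
cubic polynomial `f ∈ ℚ[x]`, then the coefficient of `x²` in `f` is nonzero (equivalently,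
the sum of the three roots of `f` is nonzero). -/
theorem coeff_two_ne_zero (l m : ℕ) (hl : 1 ≤ l) (hm : 1 ≤ m)
    (f : ℚ[X]) (hmonic : f.Monic) (hdeg : f.natDegree = 3)
    (hfac : (X ^ 6 - C ((l : ℚ) + (m : ℚ) + 3) * X ^ 4
        + C ((l : ℚ) * (m : ℚ) + (l : ℚ) + (m : ℚ) + 3) * X ^ 2 - 1 : ℚ[X])
      = -(f * f.comp (-X))) :
    f.coeff 2 ≠ 0 := by
  intro ha
  have hlead : f.coeff 3 = 1 := hdeg ▸ hmonic.coeff_natDegree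
  have heval (x : ℚ) : f.eval x = x ^ 3 + f.coeff 1 * x + f.coeff 0 := by
    rw [eval_eq_sum_range, hdeg]
    simp only [Finset.sum_range_succ, Finset.sum_range_zero, ha, hlead]
    ring
  have hq (x : ℚ) := congrArg (eval x) hfac
  simp only [eval_add, eval_sub, eval_neg, eval_mul, eval_pow, eval_X, eval_C, eval_one,
    eval_comp, heval] at hq
  have h₀ := hq 0
  have h₁ := hq 1
  have h₂ := hq 2
  have hfour : 2 * f.coeff 1 = -((l : ℚ) + m + 3) := by linarith
  have htwo : f.coeff 1 ^ 2 = (l : ℚ) * m + l + m + 3 := by linarith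
  have hl' : (1 : ℚ) ≤ l := by exact_mod_cast hl
  have hm' : (1 : ℚ) ≤ m := by exact_mod_cast hm
  have hsq : ((l : ℚ) - m) ^ 2 + 2 * (l + m) = 3 := by
    linear_combination (2 * f.coeff 1 - ((l : ℚ) + m + 3)) * -hfour + 4 * htwo
  linarith [sq_nonneg ((l : ℚ) - m)]
end

section
/- Let l ≥ 1 and m ≥ 1 be integers and q(x) = x^6 - (l+m+3)x^4 + (lm+l+m+3)x^2 - 1 ∈ ℚ[x]. If q(x) is reducible over ℚ and θ₁, θ₂, θ₃ denote the three distinct positive real roots of q, then every 3-element subset of {1, θ₁, θ₂, θ₃} is linearly independent over ℚ. -/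
open Polynomial

/-- One of the relations of Vieta: three distinct roots of a monic cubic sum to minus its
quadratic coefficient. -/
theorem add_add_eq_neg_of_cubic_roots {K : Type*} [Field K] {a b c x y z : K}
    (hx : x ^ 3 + a * x ^ 2 + b * x + c = 0) (hy : y ^ 3 + a * y ^ 2 + b * y + c = 0)
    (hz : z ^ 3 + a * z ^ 2 + b * z + c = 0) (hxy : x ≠ y) (hxz : x ≠ z) (hyz : y ≠ z) :
    x + y + z = -a := by
  have h₁ : x ^ 2 + x * y + y ^ 2 + a * (x + y) + b = 0 :=
    mul_left_cancel₀ (sub_ne_zero.2 hxy) (by linear_combination hx - hy)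
  have h₂ : x ^ 2 + x * z + z ^ 2 + a * (x + z) + b = 0 :=
    mul_left_cancel₀ (sub_ne_zero.2 hxz) (by linear_combination hx - hz)
  exact mul_left_cancel₀ (sub_ne_zero.2 hyz) (by linear_combination h₁ - h₂)

/-- A root of a rational cubic without rational roots satisfies no nontrivial rational
quadratic equation. -/
theorem eq_zero_of_quadratic_of_cubic {K : Type*} [Field K] [CharZero K] {a b c : ℚ}
    (hf : ∀ r : ℚ, r ^ 3 + a * r ^ 2 + b * r + c ≠ 0) {y : K}
    (hy : y ^ 3 + a * y ^ 2 + b * y + c = 0) {α β γ : ℚ} (h : α * y ^ 2 + β * y + γ = 0) :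
    α = 0 ∧ β = 0 ∧ γ = 0 := by
  have hlin : ∀ β γ : ℚ, (β * y + γ : K) = 0 → β = 0 ∧ γ = 0 := by
    intro β γ h
    have hβ : β = 0 := by
      by_contra hβ
      have hβ' : (β : K) ≠ 0 := by exact_mod_cast hβ
      have hyr : y = ((-γ / β : ℚ) : K) := by
        push_cast
        rw [eq_div_iff hβ']
        linear_combination h
      rw [hyr] at hy
      exact hf (-γ / β) (by exact_mod_cast hy)
    subst hβ
    exact ⟨rfl, by simpa using h⟩
  have hα : α = 0 := by
    by_contra hα
    have hα' : (α : K) ≠ 0 := by exact_mod_cast hα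
    have hquad : y ^ 2 + (β / α : ℚ) * y + (γ / α : ℚ) = 0 := by
      push_cast
      field_simp
      linear_combination h
    generalize β / α = u at hquad
    generalize γ / α = v at hquad
    obtain ⟨h₁, h₂⟩ := hlin (b - v - u * (a - u)) (c - v * (a - u)) (by
      push_cast
      linear_combination hy - (y + a - u) * hquad)
    exact hf (u - a) (by linear_combination (u - a) * h₁ + h₂)
  subst hα
  exact ⟨rfl, hlin β γ (by simpa using h)⟩

/-- Two distinct roots of a rational cubic without rational roots are linearly independent
together with `1`. -/
theorem eq_zero_of_affine_relation_of_cubic {K : Type*} [Field K] [CharZero K] {a b c : ℚ}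
    (hf : ∀ r : ℚ, r ^ 3 + a * r ^ 2 + b * r + c ≠ 0) {x y : K}
    (hx : x ^ 3 + a * x ^ 2 + b * x + c = 0) (hy : y ^ 3 + a * y ^ 2 + b * y + c = 0)
    (hxy : x ≠ y) {A B C : ℚ} (h : A + B * x + C * y = 0) : A = 0 ∧ B = 0 ∧ C = 0 := by
  have hC : C = 0 := by
    by_contra hC
    have hC' : (C : K) ≠ 0 := by exact_mod_cast hC
    obtain ⟨p, s, hps⟩ : ∃ p s : ℚ, y = p + s * x := by
      refine ⟨-A / C, -B / C, ?_⟩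
      push_cast
      field_simp
      linear_combination h
    subst hps
    have hs : s ≠ 0 := by
      rintro rfl
      exact hf p (by
        simp only [Rat.cast_zero, zero_mul, add_zero] at hy
        exact_mod_cast hy)
    obtain ⟨h₂, h₁, h₀⟩ := eq_zero_of_quadratic_of_cubic hf hx
      (α := 3 * p * s ^ 2 + a * s ^ 2 - s ^ 3 * a)
      (β := 3 * p ^ 2 * s + 2 * a * p * s + b * s - s ^ 3 * b)
      (γ := p ^ 3 + a * p ^ 2 + b * p + c - s ^ 3 * c)
      (by push_cast; linear_combination hy - s ^ 3 * hx)
    have hp : p = a * (s - 1) / 3 := by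
      have : s ^ 2 * (3 * p + a - s * a) = s ^ 2 * 0 := by linear_combination h₂
      linear_combination (mul_left_cancel₀ (pow_ne_zero 2 hs) this) / 3
    subst hp
    have hs3 : (s ^ 3 - 1) * ((-a / 3) ^ 3 + a * (-a / 3) ^ 2 + b * (-a / 3) + c) = 0 := by
      linear_combination -h₀ + a / 3 * h₁
    have hs1 : s = 1 := by
      have h3 : s ^ 3 - 1 = 0 := (mul_eq_zero.1 hs3).resolve_right (hf _)
      have : (s - 1) * (s ^ 2 + s + 1) = 0 := by linear_combination h3
      rcases mul_eq_zero.1 this with h | h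
      · linarith
      · nlinarith [sq_nonneg (2 * s + 1)]
    subst hs1
    simp at hxy
  subst hC
  obtain ⟨-, hB, hA⟩ := eq_zero_of_quadratic_of_cubic hf hx (α := 0) (β := B) (γ := A)
    (by push_cast at h ⊢; linear_combination h)
  exact ⟨hA, hB, rfl⟩

/-- The only rational relations of length at most three between `1` and the roots of a rational
cubic without rational roots and with nonzero trace are the trivial ones. -/
theorem eq_zero_of_relation_of_cubic {K : Type*} [Field K] [CharZero K] {a b c : ℚ}
    (hf : ∀ r : ℚ, r ^ 3 + a * r ^ 2 + b * r + c ≠ 0) (ha : a ≠ 0) {x y z : K}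
    (hx : x ^ 3 + a * x ^ 2 + b * x + c = 0) (hy : y ^ 3 + a * y ^ 2 + b * y + c = 0)
    (hz : z ^ 3 + a * z ^ 2 + b * z + c = 0) (hxy : x ≠ y) (hxz : x ≠ z) (hyz : y ≠ z)
    {A B C D : ℚ} (h : A + B * x + C * y + D * z = 0) (h0 : A = 0 ∨ B = 0 ∨ C = 0 ∨ D = 0) :
    A = 0 ∧ B = 0 ∧ C = 0 ∧ D = 0 := by
  rcases h0 with rfl | rfl | rfl | rfl
  · have hsum := add_add_eq_neg_of_cubic_roots hx hy hz hxy hxz hyz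
    obtain ⟨h₁, h₂, h₃⟩ := eq_zero_of_affine_relation_of_cubic hf hx hy hxy
      (A := -(D * a)) (B := B - D) (C := C - D)
      (by push_cast at h ⊢; linear_combination h - D * hsum)
    have hD : D = 0 := by simpa [ha] using h₁
    subst hD
    simpa using And.intro h₂ h₃
  · have := eq_zero_of_affine_relation_of_cubic hf hy hz hyz (A := A) (B := C) (C := D)
      (by push_cast at h; linear_combination h)
    tauto
  · have := eq_zero_of_affine_relation_of_cubic hf hx hz hxz (A := A) (B := B) (C := D)
      (by push_cast at h; linear_combination h)
    tauto
  · have := eq_zero_of_affine_relation_of_cubic hf hx hy hxy (A := A) (B := B) (C := C)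
      (by push_cast at h; linear_combination h)
    tauto

/-- The cubic `Q` with `q(x) = Q(x²)` has no rational root. -/
theorem starCubic_ne_zero {l m : ℕ} (hl : 1 ≤ l) (hm : 1 ≤ m) (r : ℚ) :
    r ^ 3 + (-(l + m + 3) : ℚ) * r ^ 2 + (l * m + l + m + 3 : ℚ) * r + (-1 : ℚ) ≠ 0 := by
  intro h
  have hint : IsIntegral ℤ r := by
    refine ⟨X ^ 3 + (C (-(l + m + 3) : ℤ) * X ^ 2 + C (l * m + l + m + 3 : ℤ) * X + C (-1)),
      monic_X_pow_add (by compute_degree!), ?_⟩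
    simp only [eval₂_add, eval₂_mul, eval₂_pow, eval₂_X, eval₂_C]
    simp
    linear_combination h
  obtain ⟨n, rfl⟩ := IsIntegrallyClosed.isIntegral_iff.1 hint
  simp only [algebraMap_int_eq, eq_intCast] at h
  have hn : n ^ 3 + (-(l + m + 3) : ℤ) * n ^ 2 + (l * m + l + m + 3 : ℤ) * n + (-1 : ℤ) = 0 := by
    exact_mod_cast h
  have hunit : IsUnit n :=
    .of_mul_eq_one (n ^ 2 - (l + m + 3) * n + (l * m + l + m + 3)) (by linear_combination hn)
  have hl' : (1 : ℤ) ≤ l := by exact_mod_cast hl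
  have hm' : (1 : ℤ) ≤ m := by exact_mod_cast hm
  have hlm : (1 : ℤ) ≤ l * m := one_le_mul_of_one_le_of_one_le hl' hm'
  rcases Int.isUnit_iff.1 hunit with rfl | rfl <;> linarith

/-- If `Q = y³ + s y² + t y + d` has no rational root and `f = k x³ + a x² + b x + c` vanishes at a
square root of a root of `Q`, then `f(x) f(-x) = -k² Q(x²)`, stated on coefficients. -/
theorem coeff_eq_of_sq_root {K : Type*} [Field K] [CharZero K] {s t d : ℚ}
    (hQ : ∀ r : ℚ, r ^ 3 + s * r ^ 2 + t * r + d ≠ 0) {z : K}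
    (hz : (z ^ 2) ^ 3 + s * (z ^ 2) ^ 2 + t * z ^ 2 + d = 0) {k a b c : ℚ}
    (hf : k * z ^ 3 + a * z ^ 2 + b * z + c = 0) :
    2 * k * b - a ^ 2 = k ^ 2 * s ∧ b ^ 2 - 2 * a * c = k ^ 2 * t ∧ -c ^ 2 = k ^ 2 * d := by
  obtain ⟨h₂, h₁, h₀⟩ := eq_zero_of_quadratic_of_cubic hQ hz
    (α := 2 * k * b - a ^ 2 - k ^ 2 * s) (β := b ^ 2 - 2 * a * c - k ^ 2 * t)
    (γ := -c ^ 2 - k ^ 2 * d) (by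
      push_cast
      linear_combination (k * z ^ 3 - a * z ^ 2 + b * z - c) * hf - k ^ 2 * hz)
  exact ⟨by linarith, by linarith, by linarith⟩

/-- If `Q(x²)` is reducible over `ℚ` and the monic cubic `Q` has no rational root, then
`Q(x²) = -f(x) f(-x)` for a monic rational cubic `f`. -/
theorem exists_cubic_factor {s t d : ℚ} (hQ : ∀ r : ℚ, r ^ 3 + s * r ^ 2 + t * r + d ≠ 0)
    {q : ℚ[X]} (hq : q = X ^ 6 + (C s * X ^ 4 + C t * X ^ 2 + C d)) (hred : ¬ Irreducible q) :
    ∃ a b c : ℚ, 2 * b - a ^ 2 = s ∧ b ^ 2 - 2 * a * c = t ∧ -c ^ 2 = d := by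
  have hdeg : q.natDegree = 6 := by rw [hq]; compute_degree!
  have hmon : q.Monic := by
    rw [hq]
    exact monic_X_pow_add (by compute_degree!)
  have hone : q ≠ 1 := by
    rintro rfl
    simp at hdeg
  rw [hmon.irreducible_iff_natDegree'] at hred
  push Not at hred
  obtain ⟨g, f, -, hfm, hgf, hfdeg⟩ := hred hone
  rw [hdeg, Finset.mem_Ioc] at hfdeg
  obtain ⟨z, hz⟩ := IsAlgClosed.exists_aeval_eq_zero ℂ f
    (by rw [degree_eq_natDegree hfm.ne_zero]; exact_mod_cast hfdeg.1.ne')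
  have hqz : aeval z q = 0 := by rw [← hgf, map_mul, hz, mul_zero]
  have hQz : (z ^ 2) ^ 3 + s * (z ^ 2) ^ 2 + t * z ^ 2 + d = 0 := by
    simp only [hq, map_add, map_mul, map_pow, aeval_X, aeval_C, eq_ratCast] at hqz
    linear_combination hqz
  have hfz : f.coeff 3 * z ^ 3 + f.coeff 2 * z ^ 2 + f.coeff 1 * z + f.coeff 0 = 0 := by
    rw [aeval_eq_sum_range' (n := 4) (by omega)] at hz
    simp only [Finset.sum_range_succ, Finset.sum_range_zero, Rat.smul_def] at hz
    linear_combination hz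
  obtain ⟨h₂, h₁, h₀⟩ := coeff_eq_of_sq_root hQ hQz hfz
  have hk : f.coeff 3 = 1 := by
    by_cases h3 : f.natDegree = 3
    · rw [← h3]
      exact hfm
    · have hk0 : f.coeff 3 = 0 := coeff_eq_zero_of_natDegree_lt (by omega)
      simp only [hk0] at h₀ h₁ h₂
      have ha : f.coeff 2 = 0 := by simpa using h₂
      have hc : f.coeff 0 = 0 := by simpa using h₀
      have hb : f.coeff 1 = 0 := by simpa [ha] using h₁
      refine absurd ?_ hfm.ne_zero
      ext n
      by_cases hn : n < 4
      · interval_cases n <;> simp [*]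
      · simpa using coeff_eq_zero_of_natDegree_lt (by omega)
  rw [hk] at h₀ h₁ h₂
  exact ⟨f.coeff 2, f.coeff 1, f.coeff 0, by linarith, by linarith, by linarith⟩

/-- Three entries of a 4-tuple are linearly independent if every relation with a vanishing
coefficient is trivial. -/
theorem linearIndependent_three_of_four {K V : Type*} [Ring K] [AddCommGroup V] [Module K V]
    {v : Fin 4 → V}
    (h : ∀ w : Fin 4 → K, ∑ x, w x • v x = 0 → (∃ x, w x = 0) → w = 0)
    {i j k : Fin 4} (hij : i ≠ j) (hik : i ≠ k) (hjk : j ≠ k) :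
    LinearIndependent K ![v i, v j, v k] := by
  obtain ⟨x, hxi, hxj, hxk⟩ : ∃ x : Fin 4, x ≠ i ∧ x ≠ j ∧ x ≠ k := by
    clear h
    revert i j k
    decide
  rw [Fintype.linearIndependent_iff]
  intro g hg
  simp only [Fin.sum_univ_three, Matrix.cons_val] at hg
  have hw := h (Pi.single i (g 0) + Pi.single j (g 1) + Pi.single k (g 2)) (by
    simpa [add_smul, Finset.sum_add_distrib, Pi.single_apply, ite_smul] using hg)
    ⟨x, by simp [hxi, hxj, hxk]⟩
  have h₀ := congrFun hw i
  have h₁ := congrFun hw j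
  have h₂ := congrFun hw k
  simp [hij, hik, hjk, hij.symm, hik.symm, hjk.symm] at h₀ h₁ h₂
  intro n
  fin_cases n <;> assumption

/-- Let `l ≥ 1` and `m ≥ 1` be integers and
`q(x) = x⁶ - (l+m+3)x⁴ + (lm+l+m+3)x² - 1 ∈ ℚ[x]`. If `q(x)` is reducible over `ℚ` and
`θ₁, θ₂, θ₃` denote the three distinct positive real roots of `q`, then every 3-element
subset of `{1, θ₁, θ₂, θ₃}` is linearly independent over `ℚ`. -/
theorem three_subsets_linearIndependent (l m : ℕ) (hl : 1 ≤ l) (hm : 1 ≤ m)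
    (q : ℚ[X])
    (hq : q = X ^ 6 - C ((l : ℚ) + (m : ℚ) + 3) * X ^ 4
      + C ((l : ℚ) * (m : ℚ) + (l : ℚ) + (m : ℚ) + 3) * X ^ 2 - 1)
    (hred : ¬ Irreducible q)
    (θ₁ θ₂ θ₃ : ℝ) (h12 : θ₁ ≠ θ₂) (h13 : θ₁ ≠ θ₃) (h23 : θ₂ ≠ θ₃)
    (hpos₁ : 0 < θ₁) (hpos₂ : 0 < θ₂) (hpos₃ : 0 < θ₃)
    (hroot₁ : aeval θ₁ q = 0) (hroot₂ : aeval θ₂ q = 0) (hroot₃ : aeval θ₃ q = 0) :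
    ∀ i j k : Fin 4, i ≠ j → i ≠ k → j ≠ k →
      LinearIndependent ℚ
        ![![(1 : ℝ), θ₁, θ₂, θ₃] i, ![(1 : ℝ), θ₁, θ₂, θ₃] j, ![(1 : ℝ), θ₁, θ₂, θ₃] k] := by
  have hQ := starCubic_ne_zero hl hm
  obtain ⟨a, b, c, h₂, h₁, h₀⟩ := exists_cubic_factor hQ (by
    rw [hq]
    simp only [map_neg, map_add, map_mul, map_one]
    ring) hred
  have hl' : (1 : ℚ) ≤ l := by exact_mod_cast hl
  have hm' : (1 : ℚ) ≤ m := by exact_mod_cast hm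
  have hf : ∀ r : ℚ, r ^ 3 + a * r ^ 2 + b * r + c ≠ 0 := fun r hr ↦ hQ (r ^ 2) (by
    rw [← h₂, ← h₁, ← h₀]
    linear_combination (r ^ 3 - a * r ^ 2 + b * r - c) * hr)
  have ha : a ≠ 0 := by
    rintro rfl
    have hb : b = -(l + m + 3) / 2 := by linarith
    subst hb
    nlinarith [sq_nonneg ((l : ℚ) - m)]
  have hsign : ∀ θ : ℝ, aeval θ q = 0 → ∃ ε : ℚ, (ε = 1 ∨ ε = -1) ∧
      (ε * θ) ^ 3 + a * (ε * θ) ^ 2 + b * (ε * θ) + c = 0 := by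
    intro θ hθ
    have h₂' : (2 * b - a ^ 2 : ℝ) = -(l + m + 3) := by exact_mod_cast h₂
    have h₁' : (b ^ 2 - 2 * a * c : ℝ) = l * m + l + m + 3 := by exact_mod_cast h₁
    have h₀' : (-c ^ 2 : ℝ) = -1 := by exact_mod_cast h₀
    simp only [hq, map_add, map_sub, map_mul, map_pow, map_one, aeval_X, map_natCast, map_ofNat] at hθ
    have hprod : (θ ^ 3 + a * θ ^ 2 + b * θ + c) * (θ ^ 3 - a * θ ^ 2 + b * θ - c) = 0 := by
      linear_combination hθ + θ ^ 4 * h₂' + θ ^ 2 * h₁' + h₀'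
    rcases mul_eq_zero.1 hprod with h | h
    · exact ⟨1, .inl rfl, by push_cast; linear_combination h⟩
    · exact ⟨-1, .inr rfl, by push_cast; linear_combination -h⟩
  have hne : ∀ {x y : ℝ} {δ ε : ℚ}, 0 < x → 0 < y → x ≠ y → (δ = 1 ∨ δ = -1) →
      (ε = 1 ∨ ε = -1) → (δ * x : ℝ) ≠ ε * y := by
    rintro x y δ ε hx hy hxy (rfl | rfl) (rfl | rfl) h <;> push_cast at h <;>
      first | linarith | exact hxy (by linarith)
  obtain ⟨ε₁, hε₁, hf₁⟩ := hsign θ₁ hroot₁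
  obtain ⟨ε₂, hε₂, hf₂⟩ := hsign θ₂ hroot₂
  obtain ⟨ε₃, hε₃, hf₃⟩ := hsign θ₃ hroot₃
  have hsq : ∀ {ε : ℚ}, (ε = 1 ∨ ε = -1) → ε ≠ 0 ∧ (ε : ℝ) ^ 2 = 1 := by
    rintro ε (rfl | rfl) <;> norm_num
  obtain ⟨hn₁, hs₁⟩ := hsq hε₁
  obtain ⟨hn₂, hs₂⟩ := hsq hε₂
  obtain ⟨hn₃, hs₃⟩ := hsq hε₃
  intro i j k hij hik hjk
  refine linearIndependent_three_of_four (fun w hw h0 ↦ ?_) hij hik hjk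
  simp only [Fin.sum_univ_four, Matrix.cons_val, Rat.smul_def] at hw
  obtain ⟨hA, hB, hC, hD⟩ := eq_zero_of_relation_of_cubic hf ha hf₁ hf₂ hf₃
    (hne hpos₁ hpos₂ h12 hε₁ hε₂) (hne hpos₁ hpos₃ h13 hε₁ hε₃) (hne hpos₂ hpos₃ h23 hε₂ hε₃)
    (A := w 0) (B := w 1 * ε₁) (C := w 2 * ε₂) (D := w 3 * ε₃)
    (by
      push_cast
      linear_combination hw + w 1 * θ₁ * hs₁ + w 2 * θ₂ * hs₂ + w 3 * θ₃ * hs₃)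
    (by simpa [Fin.exists_fin_succ, hn₁, hn₂, hn₃] using h0)
  funext x
  fin_cases x
  exacts [hA, (mul_eq_zero.1 hB).resolve_right hn₁, (mul_eq_zero.1 hC).resolve_right hn₂,
    (mul_eq_zero.1 hD).resolve_right hn₃]
end

section
/- For every integer l ≥ 1, the polynomial f(x) = x^3 - x^2 - (l+1)x + 1 is irreducible over ℚ, and x^6 - (2l+3)x^4 + (l^2+2l+3)x^2 - 1 = -f(x)·f(-x). -/
open Polynomial

theorem cubic_eval_ne_zero (l : ℕ) (hl : 1 ≤ l) (x : ℚ) :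
    x ^ 3 - x ^ 2 - ((l : ℚ) + 1) * x + 1 ≠ 0 := by
  intro hx
  have hint : IsIntegral ℤ x := by
    refine ⟨X ^ 3 - X ^ 2 - C ((l : ℤ) + 1) * X + 1, by monicity!, ?_⟩
    simpa [eval₂_add, eval₂_sub, eval₂_mul] using hx
  obtain ⟨n, rfl⟩ := IsIntegrallyClosed.isIntegral_iff.mp hint
  simp only [algebraMap_int_eq, eq_intCast] at hx
  have hn : n ^ 3 - n ^ 2 - ((l : ℤ) + 1) * n + 1 = 0 := by exact_mod_cast hx
  have hunit : IsUnit n := .of_mul_eq_one (-(n ^ 2 - n - ((l : ℤ) + 1))) (by linarith)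
  rcases Int.isUnit_iff.mp hunit with rfl | rfl <;> lia

/-- For every integer `l ≥ 1`, the polynomial `f(x) = x³ - x² - (l+1)x + 1` is irreducible
over `ℚ`, and `x⁶ - (2l+3)x⁴ + (l²+2l+3)x² - 1 = -f(x)·f(-x)`. -/
theorem equal_branches_factorization (l : ℕ) (hl : 1 ≤ l) :
    Irreducible (X ^ 3 - X ^ 2 - C ((l : ℚ) + 1) * X + 1 : ℚ[X]) ∧
      (X ^ 6 - C (2 * (l : ℚ) + 3) * X ^ 4 + C ((l : ℚ) ^ 2 + 2 * (l : ℚ) + 3) * X ^ 2 - 1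
          : ℚ[X])
        = -((X ^ 3 - X ^ 2 - C ((l : ℚ) + 1) * X + 1)
            * (X ^ 3 - X ^ 2 - C ((l : ℚ) + 1) * X + 1).comp (-X)) := by
  constructor
  · have hdeg : (X ^ 3 - X ^ 2 - C ((l : ℚ) + 1) * X + 1 : ℚ[X]).natDegree = 3 := by
      compute_degree!
    rw [irreducible_iff_roots_eq_zero_of_degree_le_three (by lia) (by lia)]
    refine Multiset.eq_zero_of_forall_notMem fun x hx => cubic_eval_ne_zero l hl x ?_
    simpa using (mem_roots'.mp hx).2
  · simp only [add_comp, sub_comp, mul_comp, pow_comp, X_comp, C_comp, one_comp, map_add,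
      map_mul, map_pow, map_one, map_ofNat]
    ring
end

section
/- For every integer l ≥ 1, if θ₁, θ₂, θ₃ denote the three distinct positive real roots of q(x) = x^6 - (2l+3)x^4 + (l^2+2l+3)x^2 - 1, then every 3-element subset of {1, θ₁, θ₂, θ₃} is linearly independent over ℚ. -/
open Polynomial

/-- The cubic factor of `q`: one has `q(x) = -p(x) p(-x)` with `p = branchCubic l`. -/
noncomputable def branchCubic (l : ℕ) : ℤ[X] := X ^ 3 - X ^ 2 - C ((l : ℤ) + 1) * X + 1

theorem branchCubic_natDegree (l : ℕ) : (branchCubic l).natDegree = 3 := by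
  unfold branchCubic; compute_degree!

theorem branchCubic_monic (l : ℕ) : (branchCubic l).Monic := by
  unfold branchCubic; monicity!

theorem aeval_branchCubic {A : Type*} [CommRing A] (l : ℕ) (x : A) :
    aeval x (branchCubic l) = x ^ 3 - x ^ 2 - ((l : A) + 1) * x + 1 := by
  simp [branchCubic]

theorem aeval_branchCubic_ne_zero {l : ℕ} (hl : 1 ≤ l) (r : ℚ) :
    aeval r (branchCubic l) ≠ 0 := by
  intro h
  obtain ⟨n, rfl⟩ := isInteger_of_is_root_of_monic (branchCubic_monic l) h
  rw [aeval_branchCubic] at h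
  have hn : n ^ 3 - n ^ 2 - ((l : ℤ) + 1) * n + 1 = 0 := by
    simp only [algebraMap_int_eq, eq_intCast] at h
    exact_mod_cast h
  have hunit : IsUnit n := IsUnit.of_mul_eq_one (-(n ^ 2 - n - ((l : ℤ) + 1))) (by linarith)
  rcases Int.isUnit_iff.mp hunit with rfl | rfl <;> norm_num at hn <;> omega

theorem branchCubic_map_irreducible {l : ℕ} (hl : 1 ≤ l) :
    Irreducible ((branchCubic l).map (algebraMap ℤ ℚ)) := by
  have hdeg : ((branchCubic l).map (algebraMap ℤ ℚ)).natDegree = 3 := by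
    rw [(branchCubic_monic l).natDegree_map, branchCubic_natDegree]
  refine irreducible_of_degree_le_three_of_not_isRoot (by rw [hdeg]; decide) fun r hr => ?_
  exact aeval_branchCubic_ne_zero hl r (by rwa [IsRoot, eval_map_algebraMap] at hr)

/-- A root of the cubic satisfies no nontrivial rational equation of degree at most two. -/
theorem quadratic_relation_trivial_s8 {l : ℕ} (hl : 1 ≤ l) {r : ℝ}
    (hr : aeval r (branchCubic l) = 0) {a b c : ℚ}
    (h : (a : ℝ) + b * r + c * r ^ 2 = 0) : a = 0 ∧ b = 0 ∧ c = 0 := by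
  have hmin : (branchCubic l).map (algebraMap ℤ ℚ) = minpoly ℚ r :=
    minpoly.eq_of_irreducible_of_monic (branchCubic_map_irreducible hl)
      (by rw [aeval_map_algebraMap, hr]) ((branchCubic_monic l).map _)
  have hdvd : (branchCubic l).map (algebraMap ℤ ℚ) ∣ C c * X ^ 2 + C b * X + C a := by
    rw [hmin]
    refine minpoly.dvd ℚ r ?_
    simp only [map_add, map_mul, map_pow, aeval_C, aeval_X, eq_ratCast]
    linarith
  have hzero : C c * X ^ 2 + C b * X + C a = 0 := by
    refine eq_zero_of_dvd_of_natDegree_lt hdvd ?_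
    rw [(branchCubic_monic l).natDegree_map, branchCubic_natDegree]
    exact natDegree_quadratic_le.trans_lt (by norm_num)
  refine ⟨?_, ?_, ?_⟩
  · simpa [coeff_X, coeff_C] using congrArg (coeff · 0) hzero
  · simpa [coeff_X, coeff_C] using congrArg (coeff · 1) hzero
  · simpa [coeff_X, coeff_C] using congrArg (coeff · 2) hzero

/-- Two distinct roots of the cubic are linearly independent together with `1`. -/
theorem two_roots_relation_trivial {l : ℕ} (hl : 1 ≤ l) {r s : ℝ} (hrs : r ≠ s)
    (hr : aeval r (branchCubic l) = 0) (hs : aeval s (branchCubic l) = 0) {a b c : ℚ}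
    (h : (a : ℝ) + b * r + c * s = 0) : a = 0 ∧ b = 0 ∧ c = 0 := by
  by_cases hc : c = 0
  · subst hc
    obtain ⟨ha, hb, -⟩ := quadratic_relation_trivial_s8 hl hr (a := a) (b := b) (c := 0)
      (by push_cast at h ⊢; linarith)
    exact ⟨ha, hb, rfl⟩
  exfalso
  -- Eliminating `s` from the divided difference of the cubic leaves a quadratic in `r`
  -- with leading coefficient `b² - b c + c²`.
  have hdiv : r ^ 2 + r * s + s ^ 2 - (r + s) - ((l : ℝ) + 1) = 0 := by
    rw [aeval_branchCubic] at hr hs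
    apply mul_left_cancel₀ (sub_ne_zero.mpr hrs)
    linear_combination hr - hs
  have hquad := quadratic_relation_trivial_s8 hl hr
    (a := a ^ 2 + a * c - c ^ 2 * (l + 1)) (b := 2 * a * b - a * c + b * c - c ^ 2)
    (c := b ^ 2 - b * c + c ^ 2) (by
      push_cast
      linear_combination (c : ℝ) ^ 2 * hdiv + (a + b * r - c * s - c * r + c : ℝ) * h)
  have hcpos : 0 < c ^ 2 := by positivity
  nlinarith [hquad.2.2, sq_nonneg (2 * b - c)]

/-- The relation `r₁ + r₂ + r₃ = 1` spans the rational relations between `1` and the roots. -/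
theorem three_roots_relation {l : ℕ} (hl : 1 ≤ l) {r₁ r₂ r₃ : ℝ}
    (h12 : r₁ ≠ r₂) (h13 : r₁ ≠ r₃) (h23 : r₂ ≠ r₃)
    (hr₁ : aeval r₁ (branchCubic l) = 0) (hr₂ : aeval r₂ (branchCubic l) = 0)
    (hr₃ : aeval r₃ (branchCubic l) = 0) {a b c d : ℚ}
    (h : (a : ℝ) + b * r₁ + c * r₂ + d * r₃ = 0) : a = -d ∧ b = d ∧ c = d := by
  have hsum : r₁ + r₂ + r₃ = 1 := by
    rw [aeval_branchCubic] at hr₁ hr₂ hr₃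
    apply mul_left_cancel₀ (mul_ne_zero (mul_ne_zero (sub_ne_zero.mpr h12)
      (sub_ne_zero.mpr h13)) (sub_ne_zero.mpr h23))
    linear_combination (r₂ - r₃) * hr₁ - (r₁ - r₃) * hr₂ + (r₁ - r₂) * hr₃
  obtain ⟨ha, hb, hc⟩ := two_roots_relation_trivial hl h12 hr₁ hr₂
    (a := a + d) (b := b - d) (c := c - d) (by
      push_cast
      linear_combination h - d * hsum)
  exact ⟨by linarith, by linarith, by linarith⟩

/-- A positive root of `q` is, up to a rational sign, a root of the cubic. -/
theorem exists_sign_aeval_branchCubic {l : ℕ} {θ : ℝ}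
    (h : aeval θ (X ^ 6 - C (2 * (l : ℚ) + 3) * X ^ 4
      + C ((l : ℚ) ^ 2 + 2 * (l : ℚ) + 3) * X ^ 2 - 1 : ℚ[X]) = 0) :
    ∃ ε : ℚ, |ε| = 1 ∧ aeval ((ε : ℝ) * θ) (branchCubic l) = 0 := by
  have hprod : aeval θ (branchCubic l) * aeval (-θ) (branchCubic l) = 0 := by
    simp only [map_sub, map_add, map_mul, map_pow, aeval_C, aeval_X, eq_ratCast, map_one] at h
    push_cast at h
    rw [aeval_branchCubic, aeval_branchCubic]
    linear_combination -h
  rcases mul_eq_zero.mp hprod with h0 | h0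
  · exact ⟨1, by simp, by simpa using h0⟩
  · exact ⟨-1, by simp, by simpa using h0⟩

theorem sign_mul_ne {ε δ : ℚ} (hε : |ε| = 1) (hδ : |δ| = 1) {x y : ℝ} (hx : 0 < x)
    (hy : 0 < y) (hxy : x ≠ y) : (ε : ℝ) * x ≠ δ * y := by
  intro h
  have hε' : |(ε : ℝ)| = 1 := by exact_mod_cast hε
  have hδ' : |(δ : ℝ)| = 1 := by exact_mod_cast hδ
  have habs := congrArg abs h
  rw [abs_mul, abs_mul, hε', hδ', abs_of_pos hx, abs_of_pos hy, one_mul, one_mul] at habs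
  exact hxy habs

/-- If all coefficients of every rational relation between four reals have the same absolute
value, then any three of them are linearly independent. -/
theorem linearIndependent_three_of_abs_eq {v : Fin 4 → ℝ}
    (hv : ∀ x : Fin 4 → ℚ, ∑ m, (x m : ℝ) * v m = 0 → ∀ m n, |x m| = |x n|)
    {i j k : Fin 4} (hij : i ≠ j) (hik : i ≠ k) (hjk : j ≠ k) :
    LinearIndependent ℚ ![v i, v j, v k] := by
  rw [Fintype.linearIndependent_iff]
  intro g hg
  simp only [Fin.sum_univ_three, Matrix.cons_val, Rat.smul_def] at hg
  let x : Fin 4 → ℚ := fun m =>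
    (if m = i then g 0 else 0) + (if m = j then g 1 else 0) + (if m = k then g 2 else 0)
  have hx : ∑ m, (x m : ℝ) * v m = 0 := by
    rw [← hg]
    simp [x, add_mul, Finset.sum_add_distrib, apply_ite (Rat.cast : ℚ → ℝ)]
  obtain ⟨m, hmi, hmj, hmk⟩ : ∃ m, m ≠ i ∧ m ≠ j ∧ m ≠ k := by
    clear * -
    revert i j k
    decide
  have hm : x m = 0 := by simp [x, hmi, hmj, hmk]
  have hall : ∀ n, x n = 0 := fun n => by
    rw [← abs_eq_zero, hv x hx n m, hm, abs_zero]
  intro n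
  fin_cases n
  · simpa [x, hij, hik] using hall i
  · simpa [x, hij.symm, hjk] using hall j
  · simpa [x, hik.symm, hjk.symm] using hall k

/-- For every integer `l ≥ 1`, if `θ₁, θ₂, θ₃` denote the three distinct positive real
roots of `q(x) = x⁶ - (2l+3)x⁴ + (l²+2l+3)x² - 1`, then every 3-element subset of
`{1, θ₁, θ₂, θ₃}` is linearly independent over `ℚ`. -/
theorem three_subsets_linearIndependent_equal_branches (l : ℕ) (hl : 1 ≤ l)
    (q : ℚ[X])
    (hq : q = X ^ 6 - C (2 * (l : ℚ) + 3) * X ^ 4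
      + C ((l : ℚ) ^ 2 + 2 * (l : ℚ) + 3) * X ^ 2 - 1)
    (θ₁ θ₂ θ₃ : ℝ) (h12 : θ₁ ≠ θ₂) (h13 : θ₁ ≠ θ₃) (h23 : θ₂ ≠ θ₃)
    (hpos₁ : 0 < θ₁) (hpos₂ : 0 < θ₂) (hpos₃ : 0 < θ₃)
    (hroot₁ : aeval θ₁ q = 0) (hroot₂ : aeval θ₂ q = 0) (hroot₃ : aeval θ₃ q = 0) :
    ∀ i j k : Fin 4, i ≠ j → i ≠ k → j ≠ k →
      LinearIndependent ℚ
        ![![(1 : ℝ), θ₁, θ₂, θ₃] i, ![(1 : ℝ), θ₁, θ₂, θ₃] j, ![(1 : ℝ), θ₁, θ₂, θ₃] k] := by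
  subst hq
  obtain ⟨ε₁, hε₁, hr₁⟩ := exists_sign_aeval_branchCubic hroot₁
  obtain ⟨ε₂, hε₂, hr₂⟩ := exists_sign_aeval_branchCubic hroot₂
  obtain ⟨ε₃, hε₃, hr₃⟩ := exists_sign_aeval_branchCubic hroot₃
  have sq_one : ∀ {ε : ℚ}, |ε| = 1 → (ε : ℝ) * ε = 1 := fun {ε} h => by
    have : ε * ε = 1 := by rw [← abs_mul_abs_self, h, one_mul]
    exact_mod_cast this
  have key : ∀ x : Fin 4 → ℚ, ∑ m, (x m : ℝ) * ![(1 : ℝ), θ₁, θ₂, θ₃] m = 0 →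
      ∀ m, |x m| = |x 3| := by
    intro x hx
    simp only [Fin.sum_univ_four, Matrix.cons_val] at hx
    obtain ⟨h0, h1, h2⟩ := three_roots_relation hl (sign_mul_ne hε₁ hε₂ hpos₁ hpos₂ h12)
      (sign_mul_ne hε₁ hε₃ hpos₁ hpos₃ h13) (sign_mul_ne hε₂ hε₃ hpos₂ hpos₃ h23) hr₁ hr₂ hr₃
      (a := x 0) (b := x 1 * ε₁) (c := x 2 * ε₂) (d := x 3 * ε₃) (by
        push_cast
        linear_combination hx + x 1 * θ₁ * sq_one hε₁ + x 2 * θ₂ * sq_one hε₂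
          + x 3 * θ₃ * sq_one hε₃)
    replace h0 := congrArg abs h0
    replace h1 := congrArg abs h1
    replace h2 := congrArg abs h2
    simp only [abs_neg, abs_mul, hε₁, hε₂, hε₃, mul_one] at h0 h1 h2
    intro m
    fin_cases m
    exacts [h0, h1, h2, rfl]
  intro i j k hij hik hjk
  exact linearIndependent_three_of_abs_eq
    (fun x hx m n => (key x hx m).trans (key x hx n).symm) hij hik hjk
end

section
/- Let l ≥ 1 and m ≥ 1 be integers and let μ₁, μ₂, μ₃ be the three distinct real roots of Q(x) = x^3 - (l+m+3)x^2 + (lm+l+m+3)x - 1. Then μ₁, μ₂, μ₃ are linearly independent over ℚ. -/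
open Polynomial

/-- A monic cubic polynomial over `ℤ` with constant term `-1` has no rational root as soon as
neither `1` nor `-1` is a root. -/
theorem rat_cubic_ne_zero (s e : ℤ) (h1 : e ≠ s) (h2 : s + e + 2 ≠ 0) (r : ℚ) :
    r ^ 3 - s * r ^ 2 + e * r - 1 ≠ 0 := by
  intro h
  have hint : IsIntegral ℤ r := by
    refine ⟨X ^ 3 - C s * X ^ 2 + C e * X - 1, by monicity!, ?_⟩
    simp only [eval₂_sub, eval₂_add, eval₂_mul, eval₂_pow, eval₂_X, eval₂_C, eval₂_one]
    exact h
  obtain ⟨n, rfl⟩ := IsIntegrallyClosed.isIntegral_iff.mp hint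
  have hn : n * (n ^ 2 - s * n + e) = 1 := by
    have h' : (n : ℚ) ^ 3 - s * n ^ 2 + e * n - 1 = 0 := h
    have : n ^ 3 - s * n ^ 2 + e * n - 1 = 0 := by exact_mod_cast h'
    linarith
  rcases Int.isUnit_iff.mp (IsUnit.of_mul_eq_one _ hn) with rfl | rfl
  · apply h1; linarith
  · apply h2; linarith

/-- If `x` is a root of an irreducible rational cubic, then `1, x, x²` are linearly independent
over `ℚ`. -/
theorem quadratic_coeffs_eq_zero {Q : ℚ[X]} (hQ : Irreducible Q) (hdeg : Q.natDegree = 3)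
    {x : ℝ} (hx : aeval x Q = 0) {u v w : ℚ} (h : (u : ℝ) * x ^ 2 + v * x + w = 0) :
    u = 0 ∧ v = 0 ∧ w = 0 := by
  have hdvd : Q ∣ C u * X ^ 2 + C v * X + C w :=
    (Dvd.intro _ (minpoly.eq_of_irreducible hQ hx)).trans (minpoly.dvd ℚ x (by simpa using h))
  have hz : C u * X ^ 2 + C v * X + C w = 0 :=
    eq_zero_of_dvd_of_natDegree_lt hdvd (hdeg ▸ natDegree_quadratic_le.trans_lt (by norm_num))
  refine ⟨?_, ?_, ?_⟩
  · simpa [coeff_X, coeff_C] using congrArg (coeff · 2) hz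
  · simpa [coeff_X, coeff_C] using congrArg (coeff · 1) hz
  · simpa [coeff_X, coeff_C] using congrArg (coeff · 0) hz

/-- Two roots of a depressed rational cubic with nonzero constant term, one of which is a
nonconstant rational affine function of the other, coincide. -/
theorem eq_of_depressed_cubic_of_affine {p q r t : ℚ} {x y : ℝ} (hq : q ≠ 0) (ht : t ≠ 0)
    (hind : ∀ u v w : ℚ, (u : ℝ) * x ^ 2 + v * x + w = 0 → u = 0 ∧ v = 0 ∧ w = 0)
    (hx : x ^ 3 + p * x + q = 0) (hy : y ^ 3 + p * y + q = 0) (hxy : y = r + t * x) :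
    y = x := by
  obtain ⟨hu, -, hw⟩ := hind (3 * t ^ 2 * r) (3 * t * r ^ 2 + p * t - t ^ 3 * p)
    (r ^ 3 + p * r + q - t ^ 3 * q) (by
      subst hxy
      push_cast
      linear_combination hy - (t : ℝ) ^ 3 * hx)
  have hr : r = 0 := by simpa [ht] using hu
  subst hr
  have ht3 : t ^ 3 = 1 := mul_right_cancel₀ hq (by linear_combination -hw)
  have ht1 : t = 1 := (by decide : Odd 3).pow_injective (by simpa using ht3)
  simpa [ht1] using hxy

/-- Let `l ≥ 1` and `m ≥ 1` be integers and let `μ₁, μ₂, μ₃` be the three distinct real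
roots of `Q(x) = x³ - (l+m+3)x² + (lm+l+m+3)x - 1`. Then `μ₁, μ₂, μ₃` are linearly
independent over `ℚ`. -/
theorem cubic_roots_linearIndependent (l m : ℕ) (hl : 1 ≤ l) (hm : 1 ≤ m)
    (Q : ℚ[X])
    (hQ : Q = X ^ 3 - C ((l : ℚ) + (m : ℚ) + 3) * X ^ 2
      + C ((l : ℚ) * (m : ℚ) + (l : ℚ) + (m : ℚ) + 3) * X - 1)
    (μ₁ μ₂ μ₃ : ℝ) (h12 : μ₁ ≠ μ₂) (h13 : μ₁ ≠ μ₃) (h23 : μ₂ ≠ μ₃)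
    (hroot₁ : aeval μ₁ Q = 0) (hroot₂ : aeval μ₂ Q = 0) (hroot₃ : aeval μ₃ Q = 0) :
    LinearIndependent ℚ ![μ₁, μ₂, μ₃] := by
  have hlm : 0 < l * m := Nat.mul_pos hl hm
  obtain ⟨s, hs⟩ : ∃ s : ℚ, s = l + m + 3 := ⟨_, rfl⟩
  obtain ⟨e, he⟩ : ∃ e : ℚ, e = l * m + l + m + 3 := ⟨_, rfl⟩
  have hs0 : s ≠ 0 := by rw [hs]; positivity
  have hnoroot : ∀ r : ℚ, r ^ 3 - s * r ^ 2 + e * r - 1 ≠ 0 := by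
    intro r
    have := rat_cubic_ne_zero (l + m + 3) (l * m + l + m + 3) (by zify at hlm; linarith)
      (by positivity) r
    push_cast at this
    rwa [hs, he]
  rw [← hs, ← he] at hQ
  have hdeg : Q.natDegree = 3 := by rw [hQ]; compute_degree!
  have hirr : Irreducible Q := by
    rw [irreducible_iff_roots_eq_zero_of_degree_le_three (by omega) (by omega)]
    refine Multiset.eq_zero_of_forall_notMem fun r hr => hnoroot r ?_
    simpa [hQ] using (mem_roots'.mp hr).2
  have hind₁ : ∀ u v w : ℚ, (u : ℝ) * μ₁ ^ 2 + v * μ₁ + w = 0 → u = 0 ∧ v = 0 ∧ w = 0 :=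
    fun u v w => quadratic_coeffs_eq_zero hirr hdeg hroot₁
  have hind₂ : ∀ u v w : ℚ, (u : ℝ) * μ₂ ^ 2 + v * μ₂ + w = 0 → u = 0 ∧ v = 0 ∧ w = 0 :=
    fun u v w => quadratic_coeffs_eq_zero hirr hdeg hroot₂
  have hev : ∀ x : ℝ, aeval x Q = 0 → x ^ 3 - s * x ^ 2 + e * x - 1 = 0 := by
    intro x hx
    simpa [hQ] using hx
  replace hroot₁ := hev _ hroot₁
  replace hroot₂ := hev _ hroot₂
  replace hroot₃ := hev _ hroot₃
  have hsum : μ₁ + μ₂ + μ₃ = s := by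
    have ha : μ₁ ^ 2 + μ₁ * μ₂ + μ₂ ^ 2 - s * (μ₁ + μ₂) + e = 0 :=
      mul_left_cancel₀ (sub_ne_zero.mpr h12) (by linear_combination hroot₁ - hroot₂)
    have hb : μ₁ ^ 2 + μ₁ * μ₃ + μ₃ ^ 2 - s * (μ₁ + μ₃) + e = 0 :=
      mul_left_cancel₀ (sub_ne_zero.mpr h13) (by linear_combination hroot₁ - hroot₃)
    exact mul_left_cancel₀ (sub_ne_zero.mpr h23) (by linear_combination ha - hb)
  rw [Fintype.linearIndependent_iff]
  intro g hg
  simp only [Fin.sum_univ_three, Matrix.cons_val, Rat.smul_def] at hg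
  obtain ⟨a, ha⟩ : ∃ a, a = g 0 - g 2 := ⟨_, rfl⟩
  obtain ⟨b, hb⟩ : ∃ b, b = g 1 - g 2 := ⟨_, rfl⟩
  have hrel : (a : ℝ) * μ₁ + b * μ₂ + g 2 * s = 0 := by
    rw [ha, hb]
    push_cast
    linear_combination hg - (g 2 : ℝ) * hsum
  suffices hab : a = 0 ∧ b = 0 ∧ g 2 = 0 by
    obtain ⟨rfl, rfl, hc⟩ := hab
    intro i
    fin_cases i <;> simp only [Fin.zero_eta, Fin.mk_one, Fin.reduceFinMk] <;> linarith
  by_cases hb0 : b = 0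
  · obtain ⟨-, ha0, hc⟩ := hind₁ 0 a (g 2 * s) (by
      rw [hb0] at hrel
      push_cast at hrel ⊢
      linear_combination hrel)
    exact ⟨ha0, hb0, by simpa [hs0] using hc⟩
  by_cases ha0 : a = 0
  · exact absurd (hind₂ 0 b (g 2 * s) (by
      rw [ha0] at hrel
      push_cast at hrel ⊢
      linear_combination hrel)).2.1 hb0
  have hb0' : (b : ℝ) ≠ 0 := by exact_mod_cast hb0
  refine absurd (sub_left_injective (eq_of_depressed_cubic_of_affine
    (x := μ₁ - s / 3) (y := μ₂ - s / 3) (p := e - s ^ 2 / 3)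
    (r := -(g 2 * s) / b - a / b * (s / 3) - s / 3) (t := -a / b)
    (hnoroot (s / 3)) (div_ne_zero (neg_ne_zero.mpr ha0) hb0) ?_ ?_ ?_ ?_)).symm h12
  · intro u v w h
    obtain ⟨hu, hv, hw⟩ := hind₁ u (v - 2 * u * (s / 3)) (w - v * (s / 3) + u * (s / 3) ^ 2) (by
      push_cast
      linear_combination h)
    subst hu
    have hv' : v = 0 := by linarith
    subst hv'
    exact ⟨rfl, rfl, by linarith⟩
  · push_cast
    linear_combination hroot₁
  · push_cast
    linear_combination hroot₂
  · push_cast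
    field_simp
    linear_combination 3 * hrel
end

section
/- For all integers l ≥ 1 and m ≥ 1, every element of the Galois group of the splitting field of q(x) = x^6 - (l+m+3)x^4 + (lm+l+m+3)x^2 - 1 over ℚ induces an even permutation of the set of complex roots of q (equivalently, the discriminant of q is the square of a rational number). -/
open Polynomial

attribute [local instance] Polynomial.Gal.splits_ℚ_ℂ

/-- The discriminant of the cubic resolvent of `q` is positive. -/
theorem cubic_resolvent_discr_pos {l m : ℚ} (hl : 0 < l) (hm : 0 < m) :
    0 < (l + m + 3) ^ 2 * (l * m + l + m + 3) ^ 2 - 4 * (l * m + l + m + 3) ^ 3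
      - 4 * (l + m + 3) ^ 3 + 18 * (l + m + 3) * (l * m + l + m + 3) - 27 := by
  have hs : 0 < l + m := add_pos hl hm
  have hp : 0 < l * m := mul_pos hl hm
  obtain ⟨d, hd, hd0⟩ : ∃ d, (l + m) ^ 2 = 4 * (l * m) + d ∧ 0 ≤ d :=
    ⟨(l - m) ^ 2, by ring, sq_nonneg _⟩
  generalize hs' : l + m = s at *
  generalize hp' : l * m = p at *
  have hb : p + l + m + 3 = p + s + 3 := by linarith
  rw [hb]
  have key : (s + 3) ^ 2 * (p + s + 3) ^ 2 - 4 * (p + s + 3) ^ 3 - 4 * (s + 3) ^ 3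
      + 18 * (s + 3) * (p + s + 3) - 27
      = 4 * s ^ 3 + 13 * p ^ 2 + 2 * s * p ^ 2 + (d ^ 2 + 14 * p * d + 2 * s * p * d + p ^ 2 * d) := by
    linear_combination (s ^ 2 + 4 * p + d + 2 * s * p + 6 * p + p ^ 2) * hd
  rw [key]
  positivity

/-- An even sextic over a field that splits has roots `±x, ±y, ±z`. -/
theorem exists_roots_of_splits_even_sextic {L : Type*} [Field L] {a b c : L}
    (h : (X ^ 6 - C a * X ^ 4 + C b * X ^ 2 - C c : L[X]).Splits) :
    ∃ x y z : L, x ^ 2 + y ^ 2 + z ^ 2 = a ∧ x ^ 2 * y ^ 2 + x ^ 2 * z ^ 2 + y ^ 2 * z ^ 2 = b ∧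
      (x * y * z) ^ 2 = c := by
  have hdeg : (X ^ 6 - C a * X ^ 4 + C b * X ^ 2 - C c : L[X]).degree = 6 := by compute_degree!
  obtain ⟨x, hx⟩ := h.exists_eval_eq_zero (by rw [hdeg]; decide)
  simp only [eval_sub, eval_add, eval_mul, eval_pow, eval_X, eval_C] at hx
  have h4 : (X ^ 4 - C (a - x ^ 2) * X ^ 2 + C (b - (a - x ^ 2) * x ^ 2) : L[X]).Splits := by
    refine h.of_dvd (ne_zero_of_degree_gt (n := 0) (by rw [hdeg]; decide)) ⟨X ^ 2 - C (x ^ 2), ?_⟩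
    have hc : c = x ^ 6 - a * x ^ 4 + b * x ^ 2 := by linear_combination -hx
    rw [hc]
    simp only [map_sub, map_add, map_mul, map_pow]
    ring
  have hdeg4 : (X ^ 4 - C (a - x ^ 2) * X ^ 2 + C (b - (a - x ^ 2) * x ^ 2) : L[X]).degree = 4 := by
    compute_degree!
  obtain ⟨y, hy⟩ := h4.exists_eval_eq_zero (by rw [hdeg4]; decide)
  simp only [eval_sub, eval_add, eval_mul, eval_pow, eval_X, eval_C] at hy
  have h2 : (X ^ 2 - C (a - x ^ 2 - y ^ 2) : L[X]).Splits := by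
    refine h4.of_dvd (ne_zero_of_degree_gt (n := 0) (by rw [hdeg4]; decide))
      ⟨X ^ 2 - C (y ^ 2), ?_⟩
    have hb : b = (a - x ^ 2) * x ^ 2 - (y ^ 4 - (a - x ^ 2) * y ^ 2) := by linear_combination hy
    rw [hb]
    simp only [map_sub, map_mul, map_pow]
    ring
  have hdeg2 : (X ^ 2 - C (a - x ^ 2 - y ^ 2) : L[X]).degree = 2 := by compute_degree!
  obtain ⟨z, hz⟩ := h2.exists_eval_eq_zero (by rw [hdeg2]; decide)
  simp only [eval_sub, eval_pow, eval_X, eval_C] at hz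
  refine ⟨x, y, z, by linear_combination hz, ?_, ?_⟩
  · linear_combination (x ^ 2 + y ^ 2) * hz - hy
  · linear_combination hx + x ^ 2 * y ^ 2 * hz - x ^ 2 * hy

theorem det_vandermonde_pm {R : Type*} [CommRing R] (x y z : R) :
    (Matrix.vandermonde ![x, -x, y, -y, z, -z]).det
      = -8 * (x * y * z) *
        ((x ^ 2 - y ^ 2) * (x ^ 2 - z ^ 2) * (y ^ 2 - z ^ 2)) ^ 2 := by
  rw [Matrix.det_vandermonde]
  simp [Fin.prod_univ_succ, Fin.prod_Ioi_succ]
  ring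

/-- If a ring homomorphism permutes a family of distinct elements and fixes its Vandermonde
determinant, the permutation is even. -/
theorem sign_eq_one_of_map_det_vandermonde {L : Type*} [Field L] [CharZero L] {n : ℕ}
    (v : Fin n → L) (σ : L →+* L) (π : Equiv.Perm (Fin n)) (hπ : ∀ i, σ (v i) = v (π i))
    (h0 : (Matrix.vandermonde v).det ≠ 0)
    (hσ : σ (Matrix.vandermonde v).det = (Matrix.vandermonde v).det) :
    Equiv.Perm.sign π = 1 := by
  have h1 : σ.mapMatrix (Matrix.vandermonde v) = (Matrix.vandermonde v).submatrix π id := by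
    ext i j
    simp [Matrix.vandermonde_apply, hπ]
  rw [RingHom.map_det, h1, Matrix.det_permute] at hσ
  have h2 := mul_right_cancel₀ h0 (hσ.trans (one_mul _).symm)
  exact Units.val_eq_one.mp (Int.cast_eq_one.mp h2)

open scoped Classical in
/-- The parity of a Galois element on the roots, read off from an enumeration of the roots in the
splitting field whose Vandermonde determinant is fixed. -/
theorem sign_galActionHom_eq_one {F E : Type*} [Field F] [CharZero F] [Field E] [Algebra F E]
    (p : F[X]) [Fact ((p.map (algebraMap F E)).Splits)] (σ : p.Gal) {n : ℕ}
    (v : Fin n → p.SplittingField) (hv : Set.range v = p.rootSet p.SplittingField)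
    (h0 : (Matrix.vandermonde v).det ≠ 0)
    (hσ : σ (Matrix.vandermonde v).det = (Matrix.vandermonde v).det) :
    Equiv.Perm.sign (Gal.galActionHom p E σ) = 1 := by
  have : CharZero p.SplittingField := charZero_of_injective_algebraMap
    (algebraMap F p.SplittingField).injective
  let w : Fin n ≃ p.rootSet p.SplittingField :=
    (Equiv.ofInjective v (Matrix.det_vandermonde_ne_zero_iff.mp h0)).trans (Equiv.setCongr hv)
  have hw : ∀ i, (w i : p.SplittingField) = v i := fun i => rfl
  let e := w.trans (Gal.rootsEquivRoots p E)
  rw [← Equiv.Perm.sign_permCongr e.symm]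
  refine sign_eq_one_of_map_det_vandermonde v (σ : p.SplittingField →+* p.SplittingField) _
    (fun i => ?_) h0 hσ
  have h1 : e.symm.permCongr (Gal.galActionHom p E σ) i = w.symm (σ • w i) := by
    change w.symm ((Gal.rootsEquivRoots p E).symm (σ • Gal.rootsEquivRoots p E (w i))) = _
    rw [Gal.smul_def, Equiv.symm_apply_apply, Equiv.symm_apply_apply]
  rw [h1, ← hw, ← hw, Equiv.apply_symm_apply]
  rfl

open scoped Classical in
/-- For all integers `l ≥ 1` and `m ≥ 1`, every element of the Galois group of the
splitting field of `q(x) = x⁶ - (l+m+3)x⁴ + (lm+l+m+3)x² - 1` over `ℚ` induces an even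
permutation of the set of complex roots of `q` (equivalently, the discriminant of `q` is
the square of a rational number). -/
theorem galois_group_even_permutations (l m : ℕ) (hl : 1 ≤ l) (hm : 1 ≤ m)
    (q : ℚ[X])
    (hq : q = X ^ 6 - C ((l : ℚ) + (m : ℚ) + 3) * X ^ 4
      + C ((l : ℚ) * (m : ℚ) + (l : ℚ) + (m : ℚ) + 3) * X ^ 2 - 1) :
    ∀ σ : q.Gal, Equiv.Perm.sign (Polynomial.Gal.galActionHom q ℂ σ) = 1 := by
  intro σ
  have hdisc := cubic_resolvent_discr_pos (l := l) (m := m) (by exact_mod_cast hl)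
    (by exact_mod_cast hm)
  generalize (l : ℚ) * m + l + m + 3 = b at hq hdisc
  generalize (l : ℚ) + m + 3 = a at hq hdisc
  set K := algebraMap ℚ q.SplittingField
  have hmap : q.map K = X ^ 6 - C (K a) * X ^ 4 + C (K b) * X ^ 2 - C 1 := by
    have h := congrArg (Polynomial.map K) hq
    simpa only [Polynomial.map_sub, Polynomial.map_add, Polynomial.map_mul, Polynomial.map_pow,
      map_X, map_C, Polynomial.map_one, map_one] using h
  have hq0 : q ≠ 0 := by
    have : q.degree = 6 := by rw [hq]; compute_degree!
    exact ne_zero_of_degree_gt (n := 0) (by rw [this]; decide)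
  have hsplit := SplittingField.splits q
  change (q.map K).Splits at hsplit
  rw [hmap] at hsplit
  obtain ⟨x, y, z, ha, hb, hc⟩ := exists_roots_of_splits_even_sextic hsplit
  have hD : ((x ^ 2 - y ^ 2) * (x ^ 2 - z ^ 2) * (y ^ 2 - z ^ 2)) ^ 2
      = K (a ^ 2 * b ^ 2 - 4 * b ^ 3 - 4 * a ^ 3 + 18 * a * b - 27) := by
    have hc' : x ^ 2 * y ^ 2 * z ^ 2 = 1 := by linear_combination hc
    simp only [map_sub, map_add, map_mul, map_pow, map_ofNat, ← ha, ← hb]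
    generalize x ^ 2 = r, y ^ 2 = s, z ^ 2 = t at hc'
    linear_combination (-4 * (r + s + t) ^ 3 + 18 * (r + s + t) * (r * s + r * t + s * t)
      - 27 * (r * s * t + 1)) * hc'
  obtain ⟨ε, hε, hxyz⟩ : ∃ ε : ℚ, ε ≠ 0 ∧ x * y * z = K ε := by
    rcases sq_eq_sq_iff_eq_or_eq_neg.mp (hc.trans (one_pow 2).symm) with h | h
    · exact ⟨1, one_ne_zero, by simpa using h⟩
    · exact ⟨-1, by norm_num, by simpa using h⟩
  have hdet : (Matrix.vandermonde ![x, -x, y, -y, z, -z]).det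
      = K (-8 * ε * (a ^ 2 * b ^ 2 - 4 * b ^ 3 - 4 * a ^ 3 + 18 * a * b - 27)) := by
    rw [det_vandermonde_pm, hD, hxyz, map_mul, map_mul, map_neg, map_ofNat]
  refine sign_galActionHom_eq_one q σ ![x, -x, y, -y, z, -z] ?_ ?_ ?_
  · ext r
    have heval : (q.map K).eval r = (r ^ 2 - x ^ 2) * (r ^ 2 - y ^ 2) * (r ^ 2 - z ^ 2) := by
      rw [hmap]
      simp only [eval_sub, eval_add, eval_mul, eval_pow, eval_X, eval_C, ← ha, ← hb, ← hc]
      ring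
    rw [mem_rootSet_of_ne hq0, aeval_def, ← eval_map]
    change _ ↔ (q.map K).eval r = 0
    rw [heval]
    simp only [mul_eq_zero, sub_eq_zero, sq_eq_sq_iff_eq_or_eq_neg, Set.mem_range,
      Fin.exists_fin_succ]
    simp [eq_comm, or_assoc]
  · rw [hdet, _root_.map_ne_zero]
    exact mul_ne_zero (mul_ne_zero (by norm_num) hε) hdisc.ne'
  · rw [hdet]
    exact AlgEquiv.commutes _ _
end

section
/- Let l ≥ 1 and m ≥ 1 be integers and q(x) = x^6 - (l+m+3)x^4 + (lm+l+m+3)x^2 - 1 ∈ ℚ[x]. If q is irreducible over ℚ and θ₁, θ₂, θ₃ denote the three distinct positive real roots of q, then the real numbers 1, θ₁, θ₂, θ₃ are linearly independent over ℚ. -/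
open Polynomial

/-- If an automorphism fixes `x` and negates `y` and `z`, and another one negates `x`, then `x` does
not occur in any rational linear relation between `1, x, y, z`. -/
lemma coeff_eq_zero_of_sign_change {K : Type*} [Field K] [Algebra ℚ K] {x y z : K} (hx : x ≠ 0)
    {σ ρ : K ≃ₐ[ℚ] K} (hσx : σ x = x) (hσy : σ y = -y) (hσz : σ z = -z) (hρ : ρ x = -x)
    {c a b d : ℚ}
    (h : algebraMap ℚ K c + algebraMap ℚ K a * x + algebraMap ℚ K b * y
      + algebraMap ℚ K d * z = 0) : c = 0 ∧ a = 0 := by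
  have : CharZero K := algebraRat.charZero K
  have h2 : (2 : K) ≠ 0 := two_ne_zero
  have h' := congrArg σ h
  simp only [map_add, map_mul, AlgEquiv.commutes, hσx, hσy, hσz, map_zero] at h'
  have e : algebraMap ℚ K c + algebraMap ℚ K a * x = 0 :=
    mul_left_cancel₀ h2 (by linear_combination h + h')
  have e' := congrArg ρ e
  simp only [map_add, map_mul, AlgEquiv.commutes, hρ, map_zero] at e'
  have hc : algebraMap ℚ K c = 0 := mul_left_cancel₀ h2 (by linear_combination e + e')
  have ha : algebraMap ℚ K a = 0 := by
    rw [hc, zero_add] at e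
    exact (mul_eq_zero.mp e).resolve_right hx
  exact ⟨(map_eq_zero _).mp hc, (map_eq_zero _).mp ha⟩

/-- If the automorphisms of `K` permute `±x, ±y, ±z` transitively and one of them fixes `x` and
negates `y` and `z`, then `1, x, y, z` satisfy no nontrivial rational linear relation. -/
lemma coeffs_eq_zero_of_sign_change {K : Type*} [Field K] [Algebra ℚ K] {x y z : K}
    (hx : x ≠ 0) (hxy : x ^ 2 ≠ y ^ 2) (hxz : x ^ 2 ≠ z ^ 2) (hyz : y ^ 2 ≠ z ^ 2)
    {P : K → Prop} (hP : ∀ w, P w ↔ w ^ 2 = x ^ 2 ∨ w ^ 2 = y ^ 2 ∨ w ^ 2 = z ^ 2)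
    (hmap : ∀ (σ : K ≃ₐ[ℚ] K) w, P w → P (σ w))
    (htrans : ∀ v w, P v → P w → ∃ σ : K ≃ₐ[ℚ] K, σ v = w)
    (hσ : ∃ σ : K ≃ₐ[ℚ] K, σ x = x ∧ σ y = -y ∧ σ z = -z) {c a b d : ℚ}
    (h : algebraMap ℚ K c + algebraMap ℚ K a * x + algebraMap ℚ K b * y
      + algebraMap ℚ K d * z = 0) : c = 0 ∧ a = 0 ∧ b = 0 ∧ d = 0 := by
  obtain ⟨σ, hσx, hσy, hσz⟩ := hσ
  have Px : P x := (hP x).2 (by simp)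
  have Py : P y := (hP y).2 (by simp)
  have Pz : P z := (hP z).2 (by simp)
  obtain ⟨ρ, hρ⟩ := htrans x (-x) Px ((hP _).2 (by simp))
  have key {c a b d : ℚ} (h : algebraMap ℚ K c + algebraMap ℚ K a * x + algebraMap ℚ K b * y
      + algebraMap ℚ K d * z = 0) := coeff_eq_zero_of_sign_change hx hσx hσy hσz hρ h
  /- The image of a root with square different from that of a preimage of `x` is `±y` or `±z`. -/
  have cases_image {τ : K ≃ₐ[ℚ] K} {v w : K} (hv : τ v = x) (Pw : P w) (hvw : v ^ 2 ≠ w ^ 2) :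
      ∃ e f : ℚ, τ w = algebraMap ℚ K e * y + algebraMap ℚ K f * z := by
    rcases (hP _).1 (hmap τ w Pw) with e | e | e
    · rw [← hv, ← map_pow, ← map_pow] at e
      exact absurd (τ.injective e).symm hvw
    · rcases sq_eq_sq_iff_eq_or_eq_neg.1 e with e | e
      exacts [⟨1, 0, by simp [e]⟩, ⟨-1, 0, by simp [e]⟩]
    · rcases sq_eq_sq_iff_eq_or_eq_neg.1 e with e | e
      exacts [⟨0, 1, by simp [e]⟩, ⟨0, -1, by simp [e]⟩]
  /- Moving another root to `x` reduces its coefficient to the one of `x`. -/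
  have move {v w u : K} (Pv : P v) (Pw : P w) (Pu : P u) (hvw : v ^ 2 ≠ w ^ 2)
      (hvu : v ^ 2 ≠ u ^ 2) {c a b d : ℚ} (h : algebraMap ℚ K c + algebraMap ℚ K a * v
      + algebraMap ℚ K b * w + algebraMap ℚ K d * u = 0) : a = 0 := by
    obtain ⟨τ, hτ⟩ := htrans v x Pv Px
    obtain ⟨e, f, hw⟩ := cases_image hτ Pw hvw
    obtain ⟨e', f', hu⟩ := cases_image hτ Pu hvu
    have h' := congrArg τ h
    simp only [map_add, map_mul, AlgEquiv.commutes, hτ, hw, hu, map_zero] at h'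
    refine (key (c := c) (a := a) (b := b * e + d * e') (d := b * f + d * f') ?_).2
    simp only [map_add, map_mul]
    linear_combination h'
  exact ⟨(key h).1, (key h).2,
    move (b := a) (d := d) (c := c) Py Px Pz hxy.symm hyz (by linear_combination h),
    move (b := a) (d := b) (c := c) Pz Px Py hxz.symm hyz.symm (by linear_combination h)⟩

/-- If the automorphisms of `K` permute `±x, ±y, ±z` transitively and `x * y * z = 1`, then
`1, x, y, z` satisfy no nontrivial rational linear relation. -/
lemma coeffs_eq_zero_of_transitive {K : Type*} [Field K] [Algebra ℚ K] {x y z : K}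
    (hxyz : x * y * z = 1) (hxy : x ^ 2 ≠ y ^ 2) (hxz : x ^ 2 ≠ z ^ 2) (hyz : y ^ 2 ≠ z ^ 2)
    {P : K → Prop} (hP : ∀ w, P w ↔ w ^ 2 = x ^ 2 ∨ w ^ 2 = y ^ 2 ∨ w ^ 2 = z ^ 2)
    (hmap : ∀ (σ : K ≃ₐ[ℚ] K) w, P w → P (σ w))
    (htrans : ∀ v w, P v → P w → ∃ σ : K ≃ₐ[ℚ] K, σ v = w) {c a b d : ℚ}
    (h : algebraMap ℚ K c + algebraMap ℚ K a * x + algebraMap ℚ K b * y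
      + algebraMap ℚ K d * z = 0) : c = 0 ∧ a = 0 ∧ b = 0 ∧ d = 0 := by
  have hx : x ≠ 0 := by rintro rfl; simp at hxyz
  have hy : y ≠ 0 := by rintro rfl; simp at hxyz
  have hz : z ≠ 0 := by rintro rfl; simp at hxyz
  obtain ⟨σ, hσ⟩ := htrans x (-x) ((hP x).2 (by simp)) ((hP _).2 (by simp))
  have hprod : -x * σ y * σ z = x * y * z := by
    rw [← hσ, ← map_mul, ← map_mul, hxyz, map_one]
  have fix_x (hσ' : ∃ σ : K ≃ₐ[ℚ] K, σ x = x ∧ σ y = -y ∧ σ z = -z) :=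
    coeffs_eq_zero_of_sign_change hx hxy hxz hyz hP hmap htrans hσ' h
  rcases (hP _).1 (hmap σ y ((hP y).2 (by simp))) with e | e | e
  · refine absurd (σ.injective ?_) hxy
    rw [map_pow, map_pow, e, hσ, neg_sq]
  · rcases sq_eq_sq_iff_eq_or_eq_neg.1 e with e | e
    · have hσz : σ z = -z := mul_left_cancel₀ (mul_ne_zero hx hy) (by
        rw [e] at hprod; linear_combination -hprod)
      obtain ⟨h1, h2, h3, h4⟩ := coeffs_eq_zero_of_sign_change (x := y) (y := x) (z := z)
        (c := c) (a := b) (b := a) (d := d) hy hxy.symm hyz hxz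
        (fun w => by rw [hP]; tauto) hmap htrans ⟨σ, e, hσ, hσz⟩ (by linear_combination h)
      exact ⟨h1, h3, h2, h4⟩
    · have hσz : σ z = z := mul_left_cancel₀ (mul_ne_zero hx hy) (by
        rw [e] at hprod; linear_combination hprod)
      obtain ⟨h1, h2, h3, h4⟩ := coeffs_eq_zero_of_sign_change (x := z) (y := x) (z := y)
        (c := c) (a := d) (b := a) (d := b) hz hxz.symm hyz.symm hxy
        (fun w => by rw [hP]; tauto) hmap htrans ⟨σ, hσz, hσ, e⟩ (by linear_combination h)
      exact ⟨h1, h3, h4, h2⟩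
  · rcases sq_eq_sq_iff_eq_or_eq_neg.1 e with e | e
    · have hσz : σ z = -y := mul_left_cancel₀ (mul_ne_zero hx hz) (by
        rw [e] at hprod; linear_combination -hprod)
      exact fix_x ⟨σ.trans σ, by simp [hσ], by simp [e, hσz], by simp [e, hσz]⟩
    · have hσz : σ z = y := mul_left_cancel₀ (mul_ne_zero hx hz) (by
        rw [e] at hprod; linear_combination hprod)
      exact fix_x ⟨σ.trans σ, by simp [hσ], by simp [e, hσz], by simp [e, hσz]⟩

/-- Vieta's formulas for a monic cubic with three distinct roots. -/
lemma cubic_vieta {K : Type*} [Field K] {A B C r s t : K} (hrs : r ≠ s) (hrt : r ≠ t) (hst : s ≠ t)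
    (hr : r ^ 3 - A * r ^ 2 + B * r - C = 0) (hs : s ^ 3 - A * s ^ 2 + B * s - C = 0)
    (ht : t ^ 3 - A * t ^ 2 + B * t - C = 0) :
    A = r + s + t ∧ B = r * s + r * t + s * t ∧ C = r * s * t := by
  have h1 : r ^ 2 + r * s + s ^ 2 - A * (r + s) + B = 0 :=
    mul_left_cancel₀ (sub_ne_zero.2 hrs) (by linear_combination hr - hs)
  have h2 : r ^ 2 + r * t + t ^ 2 - A * (r + t) + B = 0 :=
    mul_left_cancel₀ (sub_ne_zero.2 hrt) (by linear_combination hr - ht)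
  have hA : A = r + s + t :=
    mul_left_cancel₀ (sub_ne_zero.2 hst) (by linear_combination h2 - h1)
  have hB : B = r * s + r * t + s * t := by rw [hA] at h1; linear_combination h1
  refine ⟨hA, hB, ?_⟩
  rw [hA, hB] at hr
  linear_combination -hr

/-- Let `l ≥ 1` and `m ≥ 1` be integers and
`q(x) = x⁶ - (l+m+3)x⁴ + (lm+l+m+3)x² - 1 ∈ ℚ[x]`. If `q` is irreducible over `ℚ` and
`θ₁, θ₂, θ₃` denote the three distinct positive real roots of `q`, then the real numbers
`1, θ₁, θ₂, θ₃` are linearly independent over `ℚ`. -/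
theorem irreducible_roots_linearIndependent (l m : ℕ) (hl : 1 ≤ l) (hm : 1 ≤ m)
    (q : ℚ[X])
    (hq : q = X ^ 6 - C ((l : ℚ) + (m : ℚ) + 3) * X ^ 4
      + C ((l : ℚ) * (m : ℚ) + (l : ℚ) + (m : ℚ) + 3) * X ^ 2 - 1)
    (hirr : Irreducible q)
    (θ₁ θ₂ θ₃ : ℝ) (h12 : θ₁ ≠ θ₂) (h13 : θ₁ ≠ θ₃) (h23 : θ₂ ≠ θ₃)
    (hpos₁ : 0 < θ₁) (hpos₂ : 0 < θ₂) (hpos₃ : 0 < θ₃)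
    (hroot₁ : aeval θ₁ q = 0) (hroot₂ : aeval θ₂ q = 0) (hroot₃ : aeval θ₃ q = 0) :
    LinearIndependent ℚ ![(1 : ℝ), θ₁, θ₂, θ₃] := by
  have eval_eq {R : Type} [Field R] [Algebra ℚ R] (w : R) : aeval w q = (w ^ 2) ^ 3
      - algebraMap ℚ R ((l : ℚ) + (m : ℚ) + 3) * (w ^ 2) ^ 2
      + algebraMap ℚ R ((l : ℚ) * (m : ℚ) + (l : ℚ) + (m : ℚ) + 3) * w ^ 2 - 1 := by
    rw [hq]
    simp only [map_sub, aeval_add, map_mul, map_pow, aeval_X, aeval_C, map_one]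
    ring
  have sq_ne {u v : ℝ} (hu : 0 < u) (hv : 0 < v) (huv : u ≠ v) : u ^ 2 ≠ v ^ 2 :=
    fun e => huv ((pow_left_inj₀ hu.le hv.le two_ne_zero).1 e)
  have hn12 := sq_ne hpos₁ hpos₂ h12
  have hn13 := sq_ne hpos₁ hpos₃ h13
  have hn23 := sq_ne hpos₂ hpos₃ h23
  have hprod : θ₁ * θ₂ * θ₃ = 1 := by
    have hC := (cubic_vieta hn12 hn13 hn23 ((eval_eq θ₁).symm.trans hroot₁)
      ((eval_eq θ₂).symm.trans hroot₂) ((eval_eq θ₃).symm.trans hroot₃)).2.2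
    exact (pow_eq_one_iff_of_nonneg (by positivity) two_ne_zero).1 (by rw [hC]; ring)
  /- A normal extension of `ℚ` containing copies of the three real roots. -/
  let ι : ℝ →ₐ[ℚ] ℂ := Complex.ofRealAm.restrictScalars ℚ
  let val : algebraicClosure ℚ ℂ →ₐ[ℚ] ℂ := (algebraicClosure ℚ ℂ).val
  have hval : Function.Injective val := Subtype.val_injective
  have lift_root {θ : ℝ} (hθ : aeval θ q = 0) : ∃ x : algebraicClosure ℚ ℂ, val x = ι θ :=
    ⟨⟨ι θ, mem_algebraicClosure_iff.2 ⟨q, hirr.ne_zero,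
      by rw [aeval_algHom_apply, hθ, map_zero]⟩⟩, rfl⟩
  obtain ⟨x, hx⟩ := lift_root hroot₁
  obtain ⟨y, hy⟩ := lift_root hroot₂
  obtain ⟨z, hz⟩ := lift_root hroot₃
  have root_lift {θ : ℝ} {w : algebraicClosure ℚ ℂ} (hw : val w = ι θ) (hθ : aeval θ q = 0) :
      aeval w q = 0 := by
    apply hval
    rw [← aeval_algHom_apply, hw, aeval_algHom_apply, hθ, map_zero,
      map_zero]
  have sq_ne_lift {u v : ℝ} {s t : algebraicClosure ℚ ℂ} (hs : val s = ι u) (ht : val t = ι v)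
      (huv : u ^ 2 ≠ v ^ 2) : s ^ 2 ≠ t ^ 2 := fun e => huv <| ι.injective <| by
    have := congrArg val e
    simpa [hs, ht] using this
  have hxy := sq_ne_lift hx hy hn12
  have hxz := sq_ne_lift hx hz hn13
  have hyz := sq_ne_lift hy hz hn23
  have hxyz : x * y * z = 1 := by
    apply hval
    simp only [map_mul, hx, hy, hz, map_one]
    rw [← map_mul, ← map_mul, hprod, map_one]
  obtain ⟨hA, hB, hC⟩ := cubic_vieta hxy hxz hyz ((eval_eq x).symm.trans (root_lift hx hroot₁))
    ((eval_eq y).symm.trans (root_lift hy hroot₂)) ((eval_eq z).symm.trans (root_lift hz hroot₃))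
  have root_iff (w : algebraicClosure ℚ ℂ) :
      aeval w q = 0 ↔ w ^ 2 = x ^ 2 ∨ w ^ 2 = y ^ 2 ∨ w ^ 2 = z ^ 2 := by
    have : aeval w q = (w ^ 2 - x ^ 2) * ((w ^ 2 - y ^ 2) * (w ^ 2 - z ^ 2)) := by
      rw [eval_eq, hA, hB]
      linear_combination -hC
    rw [this, mul_eq_zero, mul_eq_zero, sub_eq_zero, sub_eq_zero, sub_eq_zero]
  have hnormal : Normal ℚ (algebraicClosure ℚ ℂ) := (algebraicClosure.isAlgClosure ℚ ℂ).normal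
  have htrans (v w : algebraicClosure ℚ ℂ) (hv : aeval v q = 0) (hw : aeval w q = 0) :
      ∃ σ : algebraicClosure ℚ ℂ ≃ₐ[ℚ] algebraicClosure ℚ ℂ, σ v = w :=
    minpoly.exists_algEquiv_of_root' (Algebra.IsAlgebraic.isAlgebraic v) (by
      rw [← minpoly.eq_of_irreducible hirr hv, map_mul, hw, zero_mul])
  rw [Fintype.linearIndependent_iff]
  intro g hg
  simp only [Fin.sum_univ_four, Matrix.cons_val, Algebra.smul_def, mul_one] at hg
  obtain ⟨h0, h1, h2, h3⟩ := coeffs_eq_zero_of_transitive (c := g 0) (a := g 1) (b := g 2)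
    (d := g 3) hxyz hxy hxz hyz root_iff
    (fun σ w hw => by rw [aeval_algHom_apply σ w, hw, map_zero]) htrans (by
      apply hval
      have := congrArg ι hg
      simpa only [map_add, map_mul, AlgHom.commutes, hx, hy, hz,
        map_zero] using this)
  intro i
  fin_cases i
  exacts [h0, h1, h2, h3]
end

section
/- Let l ≥ 1 and m ≥ 1 be integers and let A be the adjacency matrix of the double subdivided star T_{l,m}. If v is a real vector indexed by the vertices of T_{l,m} satisfying A·v = v or A·v = -v, then v vanishes at both coalescence vertices a and b. -/
/-- A row of `adjMat` acts by summing over the neighbours of the row's vertex. -/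
theorem adjMat_mulVec_eq_sum {l m : ℕ} {R : Type*} [NonAssocSemiring R] (v : DV l m → R)
    (p : DV l m) (s : Finset (DV l m)) (hs : ∀ q, p.adj q = true ↔ q ∈ s) :
    (adjMat l m R).mulVec v p = ∑ q ∈ s, v q := by
  simp [Matrix.mulVec, dotProduct, adjMat, hs]

/-- If `q` is the only neighbour of `p`, and `r` is the only other neighbour of `q`, then
an eigenvector of `adjMat` with eigenvalue `1` or `-1` vanishes at `r`. -/
theorem eigenvector_eq_zero_of_pendant_path {l m : ℕ} {R : Type*} [Ring R] {v : DV l m → R}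
    (hv : (adjMat l m R).mulVec v = v ∨ (adjMat l m R).mulVec v = -v)
    {p q r : DV l m} (hrp : r ≠ p) (hp : ∀ t, p.adj t = true ↔ t = q)
    (hq : ∀ t, q.adj t = true ↔ t = r ∨ t = p) : v r = 0 := by
  have hrow_p := adjMat_mulVec_eq_sum v p {q} (by simpa using hp)
  have hrow_q := adjMat_mulVec_eq_sum v q {r, p} (by simpa using hq)
  rw [Finset.sum_singleton] at hrow_p
  rw [Finset.sum_pair hrp] at hrow_q
  rcases hv with hv | hv <;> rw [hv] at hrow_p hrow_q
  · simpa [← hrow_p] using hrow_q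
  · simpa [← hrow_p] using hrow_q

/-- Let `l ≥ 1` and `m ≥ 1` be integers and `A` the adjacency matrix of the double
subdivided star `T_{l,m}`. If `v` is a real vector indexed by the vertices of `T_{l,m}`
satisfying `A·v = v` or `A·v = -v`, then `v` vanishes at both coalescence vertices
`a` and `b`. -/
theorem eigenvector_pm_one_vanishes (l m : ℕ) (hl : 1 ≤ l) (hm : 1 ≤ m)
    (v : DV l m → ℝ)
    (hv : (adjMat l m ℝ).mulVec v = v ∨ (adjMat l m ℝ).mulVec v = -v) :
    v DV.a = 0 ∧ v DV.b = 0 := by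
  constructor
  · refine eigenvector_eq_zero_of_pendant_path hv (p := .x ⟨0, hl⟩) (q := .y ⟨0, hl⟩)
      (by simp) ?_ ?_ <;> rintro (_ | _) <;> simp [DV.adj, eq_comm]
  · refine eigenvector_eq_zero_of_pendant_path hv (p := .u ⟨0, hm⟩) (q := .w ⟨0, hm⟩)
      (by simp) ?_ ?_ <;> rintro (_ | _) <;> simp [DV.adj, eq_comm]
end
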